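/- arXiv:2103.13542 — 2 statements merged into one kernel-verified Lean document; each statement's English description precedes it below -/
import Mathlib

section
/- Let q ≥ 1 and let χ be a non-principal Dirichlet character modulo q, with χ₀ the principal character modulo q. Then the limit over primes Π = lim_{Y→∞} ∏_{p ≤ Y} [(1 − 1/p)² · Σ_{m=0}^∞ χ₀(p^m)|(1*χ)(p^m)|²/p^m] exists, where (1*χ)(n) = Σ_{d | n} χ(d) is the Dirichlet convolution of the constant function 1 with χ, and Π = (6/π²)·|L(1,χ)|²·(φ(q)/q)·∏_{p | q}(1 − 1/(p+1)), where φ is Euler's totient function and L(1,χ) is the value of the Dirichlet L-function of χ at s = 1. -/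
open Complex Filter MeasureTheory Finset HurwitzZeta
open scoped ArithmeticFunction Real Classical

noncomputable section

/-- The finite set of primes `p ≤ X`. -/
def primesUpTo (X : ℝ) : Finset ℕ :=
  (Finset.range (Nat.floor X + 1)).filter (fun p => p.Prime ∧ (p : ℝ) ≤ X)

/-- The finite set of naturals `n ≤ X`. -/
def natsUpTo (X : ℝ) : Finset ℕ :=
  (Finset.range (Nat.floor X + 1)).filter (fun n => (n : ℝ) ≤ X)

/-- Truncated Euler product `P_X(s,χ)`, defined via the primitive character `χ*` inducing `χ`:
`P_X(s,χ) = ∏_{p ∣ q} (1 - χ*(p) p^{-s}) · exp(∑_{n ≤ X} χ*(n) Λ(n) / (n^s log n))`. -/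
def PX {q : ℕ} (X : ℝ) (χ : DirichletCharacter ℂ q) (s : ℂ) : ℂ :=
  (∏ p ∈ q.primeFactors, (1 - χ.primitiveCharacter ((p : ℕ) : ZMod χ.conductor) * (p : ℂ) ^ (-s))) *
    Complex.exp (∑ n ∈ natsUpTo X,
      χ.primitiveCharacter ((n : ℕ) : ZMod χ.conductor) * (Λ n : ℂ) / ((n : ℂ) ^ s * (Real.log n : ℂ)))

/-- `𝓟_X^ℓ(s) = ∏_χ P_X(s,χ)^{ℓ_χ}`. -/
def PXl {q : ℕ} (X : ℝ) (ℓ : DirichletCharacter ℂ q → ℕ) (s : ℂ) : ℂ :=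
  ∏ χ : DirichletCharacter ℂ q, (PX X χ s) ^ (ℓ χ)

/-- A Dirichlet character as an arithmetic function. -/
def chiArith {q : ℕ} (χ : DirichletCharacter ℂ q) : ArithmeticFunction ℂ :=
  ⟨fun n => if n = 0 then 0 else χ ((n : ℕ) : ZMod q), by simp⟩

/-- `d_ℓ`, the coefficients of the Dirichlet series of `𝓛^ℓ(s) = ∏_χ L(s,χ)^{ℓ_χ}`,
i.e. the Dirichlet convolution product `∏_χ χ^{*ℓ_χ}`. -/
def dcoef {q : ℕ} (ℓ : DirichletCharacter ℂ q → ℕ) : ArithmeticFunction ℂ :=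
  ∏ χ : DirichletCharacter ℂ q, (chiArith χ) ^ (ℓ χ)

/-- `P*_X(s,χ) = ∏_{p ≤ X}(1 − χ(p)p^{−s})^{−1} · ∏_{√X < p ≤ X}(1 + χ(p)²/(2p^{2s}))^{−1}`. -/
def PstarX {q : ℕ} (X : ℝ) (χ : DirichletCharacter ℂ q) (s : ℂ) : ℂ :=
  ((primesUpTo X).prod (fun p : ℕ => (1 - χ ((p : ℕ) : ZMod q) * (p : ℂ) ^ (-s))⁻¹)) *
    ((primesUpTo X).filter (fun p : ℕ => Real.sqrt X < (p : ℝ))).prod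
      (fun p : ℕ => (1 + χ ((p : ℕ) : ZMod q) ^ 2 / (2 * (p : ℂ) ^ (2 * s)))⁻¹)

/-- `𝓟*_X^ℓ(s) = ∏_χ P*_X(s,χ)^{ℓ_χ}`. -/
def PstarXl {q : ℕ} (X : ℝ) (ℓ : DirichletCharacter ℂ q → ℕ) (s : ℂ) : ℂ :=
  ∏ χ : DirichletCharacter ℂ q, (PstarX X χ s) ^ (ℓ χ)

/-- `Q_X(s,χ) = ∏_{p ≤ √X}(1 − χ(p)p^{−s}) · ∏_{√X < p ≤ X}(1 − χ(p)p^{−s} + χ(p)²/(2p^{2s}))`. -/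
def QX {q : ℕ} (X : ℝ) (χ : DirichletCharacter ℂ q) (s : ℂ) : ℂ :=
  (((primesUpTo X).filter (fun p : ℕ => (p : ℝ) ≤ Real.sqrt X)).prod
      (fun p : ℕ => 1 - χ ((p : ℕ) : ZMod q) * (p : ℂ) ^ (-s))) *
    ((primesUpTo X).filter (fun p : ℕ => Real.sqrt X < (p : ℝ))).prod
      (fun p : ℕ => 1 - χ ((p : ℕ) : ZMod q) * (p : ℂ) ^ (-s)
        + χ ((p : ℕ) : ZMod q) ^ 2 / (2 * (p : ℂ) ^ (2 * s)))

/-- `𝓠_X^ℓ(s) = ∏_χ Q_X(s,χ)^{ℓ_χ}`. -/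
def QXl {q : ℕ} (X : ℝ) (ℓ : DirichletCharacter ℂ q → ℕ) (s : ℂ) : ℂ :=
  ∏ χ : DirichletCharacter ℂ q, (QX X χ s) ^ (ℓ χ)

/-- `𝓛^ℓ(s) = ∏_χ L(s,χ)^{ℓ_χ}`. -/
def Ll {q : ℕ} [NeZero q] (ℓ : DirichletCharacter ℂ q → ℕ) (s : ℂ) : ℂ :=
  ∏ χ : DirichletCharacter ℂ q, (DirichletCharacter.LFunction χ s) ^ (ℓ χ)

/-- GRH for the Dirichlet L-functions modulo `q`: every zero `ρ` of `L(s,χ)` with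
`0 < Re ρ < 1` satisfies `Re ρ = 1/2`. -/
def GRHmod (q : ℕ) [NeZero q] : Prop :=
  ∀ χ : DirichletCharacter ℂ q, ∀ ρ : ℂ,
    DirichletCharacter.LFunction χ ρ = 0 → 0 < ρ.re → ρ.re < 1 → ρ.re = 1 / 2

end

/-- Abel's inequality: summing against nonnegative decreasing weights. -/
lemma norm_sum_Ico_mul_le_of_antitone {c : ℕ → ℂ} {B : ℝ}
    (hB : ∀ N, ‖∑ n ∈ range N, c n‖ ≤ B) {w : ℕ → ℝ} {M : ℕ}
    (hw : ∀ n, M ≤ n → w (n + 1) ≤ w n) (hw0 : ∀ n, M ≤ n → 0 ≤ w n) {N : ℕ} (hMN : M ≤ N) :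
    ‖∑ n ∈ Ico M N, (w n : ℂ) * c n‖ ≤ 2 * B * w M := by
  have hT : ∀ N, M ≤ N → ‖∑ n ∈ Ico M N, c n‖ ≤ 2 * B := fun N hN ↦ by
    rw [sum_Ico_eq_sub _ hN]
    linarith [norm_sub_le (∑ n ∈ range N, c n) (∑ n ∈ range M, c n), hB N, hB M]
  have key : ‖∑ n ∈ Ico M N, (w n : ℂ) * c n - w N * ∑ n ∈ Ico M N, c n‖
      ≤ 2 * B * (w M - w N) := by
    induction N, hMN using Nat.le_induction with
    | base => simp
    | succ N hN ih =>
      have h1 : ∑ n ∈ Ico M (N + 1), (w n : ℂ) * c n - w (N + 1) * ∑ n ∈ Ico M (N + 1), c n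
          = (∑ n ∈ Ico M N, (w n : ℂ) * c n - w N * ∑ n ∈ Ico M N, c n)
            + ((w N - w (N + 1) : ℝ) : ℂ) * ∑ n ∈ Ico M (N + 1), c n := by
        rw [sum_Ico_succ_top hN, sum_Ico_succ_top hN]
        push_cast
        ring
      have h2 : ‖((w N - w (N + 1) : ℝ) : ℂ) * ∑ n ∈ Ico M (N + 1), c n‖
          ≤ (w N - w (N + 1)) * (2 * B) := by
        rw [norm_mul, norm_real, Real.norm_of_nonneg (sub_nonneg.2 (hw N hN))]
        exact mul_le_mul_of_nonneg_left (hT _ (by lia)) (sub_nonneg.2 (hw N hN))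
      rw [h1]
      refine (norm_add_le _ _).trans ?_
      linarith
  have h3 : ‖(w N : ℂ) * ∑ n ∈ Ico M N, c n‖ ≤ w N * (2 * B) := by
    rw [norm_mul, norm_real, Real.norm_of_nonneg (hw0 N hMN)]
    exact mul_le_mul_of_nonneg_left (hT _ hMN) (hw0 N hMN)
  have h4 := norm_add_le (∑ n ∈ Ico M N, (w n : ℂ) * c n - w N * ∑ n ∈ Ico M N, c n)
    ((w N : ℂ) * ∑ n ∈ Ico M N, c n)
  rw [sub_add_cancel] at h4
  linarith

/-- Dirichlet's test for uniform convergence. -/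
lemma uniformCauchySeqOn_sum_mul_of_antitone {α : Type*} {s : Set α} {c : ℕ → ℂ} {B : ℝ}
    (hB : ∀ N, ‖∑ n ∈ range N, c n‖ ≤ B) {w : α → ℕ → ℝ} {W : ℕ → ℝ} (n₀ : ℕ)
    (hw : ∀ a ∈ s, ∀ n, n₀ ≤ n → w a (n + 1) ≤ w a n)
    (hw0 : ∀ a ∈ s, ∀ n, n₀ ≤ n → 0 ≤ w a n)
    (hwW : ∀ a ∈ s, ∀ n, n₀ ≤ n → w a n ≤ W n) (hW : Tendsto W atTop (nhds 0)) :
    UniformCauchySeqOn (fun N a ↦ ∑ n ∈ range N, (w a n : ℂ) * c n) atTop s := by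
  have hB0 : 0 ≤ B := (norm_nonneg _).trans (hB 0)
  rw [Metric.uniformCauchySeqOn_iff]
  intro ε hε
  have hlim : Tendsto (fun n ↦ 2 * B * W n) atTop (nhds 0) := by
    simpa using hW.const_mul (2 * B)
  obtain ⟨N, hN⟩ := ((hlim.eventually (gt_mem_nhds hε)).and (eventually_ge_atTop n₀)).exists_forall_of_atTop
  have main : ∀ m ≥ N, ∀ n ≥ m, ∀ a ∈ s, dist (∑ n ∈ range n, (w a n : ℂ) * c n)
      (∑ n ∈ range m, (w a n : ℂ) * c n) < ε := by
    intro m hm n hn a ha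
    obtain ⟨h1, h2⟩ := hN m hm
    rw [dist_eq_norm, ← sum_Ico_eq_sub _ hn]
    refine (norm_sum_Ico_mul_le_of_antitone hB (fun k hk ↦ hw a ha k (h2.trans hk))
      (fun k hk ↦ hw0 a ha k (h2.trans hk)) hn).trans_lt (lt_of_le_of_lt ?_ h1)
    exact mul_le_mul_of_nonneg_left (hwW a ha m h2) (by positivity)
  refine ⟨N, fun m hm n hn a ha ↦ ?_⟩
  rcases le_total m n with h | h
  · rw [dist_comm]; exact main m hm n h a ha
  · exact main n hn m h a ha

lemma UniformCauchySeqOn.exists_continuousOn_limit {F : ℕ → ℝ → ℂ} {s : Set ℝ}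
    (hF : UniformCauchySeqOn F atTop s) (hc : ∀ n, ContinuousOn (F n) s) :
    ∃ f : ℝ → ℂ, ContinuousOn f s ∧ TendstoUniformlyOn F f atTop s := by
  have h : ∀ x, ∃ y, x ∈ s → Tendsto (fun n ↦ F n x) atTop (nhds y) := fun x ↦ by
    by_cases hx : x ∈ s
    · obtain ⟨y, hy⟩ := cauchySeq_tendsto_of_complete (hF.cauchySeq hx)
      exact ⟨y, fun _ ↦ hy⟩
    · exact ⟨0, fun h ↦ absurd h hx⟩
  choose f hf using h
  have hu := hF.tendstoUniformlyOn_of_tendsto (fun x hx ↦ hf x hx)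
  exact ⟨f, hu.continuousOn (Frequently.of_forall hc), hu⟩

/-- The partial sums of a nonprincipal character are bounded. -/
lemma DirichletCharacter.norm_sum_range_le {q : ℕ} [NeZero q] {χ : DirichletCharacter ℂ q}
    (hχ : χ ≠ 1) (N : ℕ) : ‖∑ n ∈ range N, χ (n : ZMod q)‖ ≤ q := by
  have hq : ∑ n ∈ range q, χ (n : ZMod q) = 0 := by
    rw [← MulChar.sum_eq_zero_of_ne_one hχ]
    refine sum_bij' (fun a _ ↦ (a : ZMod q)) (fun a _ ↦ a.val) ?_ ?_ ?_ ?_ ?_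
    · simp
    · intro a _; simpa using a.val_lt
    · intro a ha; exact ZMod.val_cast_of_lt (mem_range.1 ha)
    · simp
    · simp
  have hk : ∀ k, ∑ n ∈ range (q * k), χ (n : ZMod q) = 0 := fun k ↦ by
    induction k with
    | zero => simp
    | succ k ih =>
      rw [mul_add_one, sum_range_add, ih, zero_add]
      simpa using hq
  rw [← Nat.div_add_mod N q, sum_range_add, hk, zero_add]
  refine (norm_sum_le _ _).trans ((sum_le_sum fun _ _ ↦ χ.norm_le_one _).trans ?_)
  simpa using (Nat.mod_lt N (NeZero.pos q)).le

lemma continuousOn_natCast_rpow_neg_one_add (n : ℕ) :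
    ContinuousOn (fun ε : ℝ ↦ (n : ℝ) ^ (-(1 + ε))) (Set.Ici 0) := by
  rcases eq_or_ne n 0 with rfl | hn
  · refine (continuousOn_const (c := (0 : ℝ))).congr fun ε hε ↦ ?_
    have : -(1 + ε) ≠ 0 := by have : 0 ≤ ε := hε; linarith
    rw [Nat.cast_zero, Real.zero_rpow this]
  · have : (n : ℝ) ≠ 0 := mod_cast hn
    fun_prop (disch := simp [hn])

lemma natCast_rpow_neg_one_add_antitone {ε : ℝ} (hε : 0 ≤ ε) {n : ℕ} (hn : 1 ≤ n) :
    ((n + 1 : ℕ) : ℝ) ^ (-(1 + ε)) ≤ (n : ℝ) ^ (-(1 + ε)) :=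
  Real.rpow_le_rpow_of_nonpos (by positivity) (by simp) (by linarith)

lemma natCast_rpow_neg_one_add_le {ε : ℝ} (hε : 0 ≤ ε) {n : ℕ} (hn : 1 ≤ n) :
    (n : ℝ) ^ (-(1 + ε)) ≤ (n : ℝ)⁻¹ := by
  rw [← Real.rpow_neg_one]
  exact Real.rpow_le_rpow_of_exponent_le (mod_cast hn) (by linarith)

lemma ofReal_natCast_rpow (n : ℕ) (x : ℝ) : (((n : ℝ) ^ x : ℝ) : ℂ) = (n : ℂ) ^ (x : ℂ) := by
  rw [ofReal_cpow (by positivity), ofReal_natCast]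

lemma DirichletCharacter.tendsto_LFunction_one_add {q : ℕ} [NeZero q]
    {χ : DirichletCharacter ℂ q} (hχ : χ ≠ 1) :
    Tendsto (fun ε : ℝ ↦ LFunction χ (1 + ε)) (nhdsWithin 0 (Set.Ioi 0)) (nhds (LFunction χ 1)) := by
  have h : Continuous (fun ε : ℝ ↦ LFunction χ (1 + ε)) :=
    (differentiable_LFunction hχ).continuous.comp (by fun_prop)
  simpa using (h.tendsto 0).mono_left nhdsWithin_le_nhds

lemma DirichletCharacter.tendsto_sum_range_inv_mul {q : ℕ} [NeZero q]
    {χ : DirichletCharacter ℂ q} (hχ : χ ≠ 1) :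
    Tendsto (fun N ↦ ∑ n ∈ range N, (((n : ℝ)⁻¹ : ℝ) : ℂ) * χ (n : ZMod q)) atTop
      (nhds (LFunction χ 1)) := by
  have hU := uniformCauchySeqOn_sum_mul_of_antitone (s := Set.Ici (0 : ℝ)) (norm_sum_range_le hχ)
    (w := fun ε n ↦ (n : ℝ) ^ (-(1 + ε))) (W := fun n ↦ (n : ℝ)⁻¹) 1
    (fun ε hε n hn ↦ natCast_rpow_neg_one_add_antitone hε hn) (fun ε hε n hn ↦ by positivity)
    (fun ε hε n hn ↦ natCast_rpow_neg_one_add_le hε hn) tendsto_inv_atTop_nhds_zero_nat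
  obtain ⟨f, hfc, hf⟩ := hU.exists_continuousOn_limit fun N ↦ by
    refine continuousOn_finsetSum _ fun n _ ↦ ContinuousOn.mul ?_ continuousOn_const
    exact continuous_ofReal.comp_continuousOn (continuousOn_natCast_rpow_neg_one_add n)
  have hpos : ∀ ε : ℝ, 0 < ε → f ε = LFunction χ (1 + ε) := fun ε hε ↦ by
    have h1 : 1 < (1 + ε : ℂ).re := by simpa using hε
    refine tendsto_nhds_unique (hf.tendsto_at hε.le) ?_
    rw [LFunction_eq_LSeries χ h1]
    refine ((χ.LSeriesSummable_of_one_lt_re h1).hasSum).tendsto_sum_nat.congr fun N ↦ ?_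
    refine sum_congr rfl fun n _ ↦ ?_
    rcases eq_or_ne n 0 with rfl | hn
    · rw [LSeries.term_zero, Nat.cast_zero, Real.zero_rpow (by linarith), ofReal_zero, zero_mul]
    · rw [LSeries.term_of_ne_zero hn, ofReal_natCast_rpow]
      push_cast
      rw [cpow_neg, div_eq_mul_inv, mul_comm]
  have h0 : f 0 = LFunction χ 1 := by
    refine tendsto_nhds_unique (((hfc 0 Set.self_mem_Ici).tendsto).mono_left
      (nhdsWithin_mono _ Set.Ioi_subset_Ici_self)) ?_
    exact (tendsto_LFunction_one_add hχ).congr'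
      (eventually_nhdsWithin_of_forall fun ε hε ↦ (hpos ε hε).symm)
  have := hf.tendsto_at Set.self_mem_Ici
  simpa [h0, Real.rpow_neg_one] using this

lemma DirichletCharacter.norm_LFunction_one_sub_sum_le {q : ℕ} [NeZero q]
    {χ : DirichletCharacter ℂ q} (hχ : χ ≠ 1) {M : ℕ} (hM : 1 ≤ M) :
    ‖LFunction χ 1 - ∑ n ∈ range M, (((n : ℝ)⁻¹ : ℝ) : ℂ) * χ (n : ZMod q)‖
      ≤ 2 * q * (M : ℝ)⁻¹ := by
  refine le_of_tendsto ((tendsto_sum_range_inv_mul hχ).sub_const _).norm ?_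
  filter_upwards [eventually_ge_atTop M] with N hN
  rw [← sum_Ico_eq_sub _ hN]
  refine norm_sum_Ico_mul_le_of_antitone (w := fun n ↦ (n : ℝ)⁻¹) (norm_sum_range_le hχ) ?_ ?_ hN
  · intro n hn
    have : (0 : ℝ) < n := mod_cast hM.trans hn
    exact inv_anti₀ this (by simp)
  · intro n _
    positivity

lemma log_natCast_div_antitone {n : ℕ} (hn : 3 ≤ n) :
    Real.log (n + 1 : ℕ) / (n + 1 : ℕ) ≤ Real.log n / n := by
  have h3 : Real.exp 1 ≤ n := Real.exp_one_lt_d9.le.trans (by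
    have : (3 : ℝ) ≤ n := mod_cast hn
    linarith)
  exact Real.log_div_self_antitoneOn h3 (h3.trans (by simp)) (by simp)

lemma DirichletCharacter.exists_norm_sum_log_div_mul_le {q : ℕ} [NeZero q]
    {χ : DirichletCharacter ℂ q} (hχ : χ ≠ 1) :
    ∃ K, ∀ N, ‖∑ n ∈ range N, ((Real.log n / n : ℝ) : ℂ) * χ (n : ZMod q)‖ ≤ K := by
  have hW : Tendsto (fun n : ℕ ↦ Real.log n / n) atTop (nhds 0) := by
    simpa [Function.comp_def] using (Real.isLittleO_log_id_atTop.tendsto_div_nhds_zero).comp tendsto_natCast_atTop_atTop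
  have hU := uniformCauchySeqOn_sum_mul_of_antitone (s := (Set.univ : Set Unit))
    (norm_sum_range_le hχ) (w := fun _ n ↦ Real.log n / n) 3
    (fun _ _ n hn ↦ log_natCast_div_antitone hn)
    (fun _ _ n _ ↦ div_nonneg (Real.log_natCast_nonneg n) (by positivity))
    (fun _ _ _ _ ↦ le_rfl) hW
  obtain ⟨R, -, hR⟩ := cauchySeq_bdd (hU.cauchySeq (Set.mem_univ ()))
  refine ⟨R, fun N ↦ ?_⟩
  simpa [dist_eq_norm] using (hR N 0).le

lemma sum_Ioc_zero_eq_sum_range {f : ℕ → ℂ} (hf : f 0 = 0) (N : ℕ) :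
    ∑ n ∈ Ioc 0 N, f n = ∑ n ∈ range (N + 1), f n := by
  rw [range_eq_Ico, sum_eq_sum_Ico_succ_bot (by lia), hf, zero_add]
  rfl

lemma DirichletCharacter.sum_log_div_mul_eq {q : ℕ} (χ : DirichletCharacter ℂ q) (N : ℕ) :
    ∑ n ∈ Ioc 0 N, ((Real.log n / n : ℝ) : ℂ) * χ (n : ZMod q) =
      ∑ d ∈ Ioc 0 N, ((Λ d / d : ℝ) : ℂ) * χ (d : ZMod q) *
        ∑ m ∈ Ioc 0 (N / d), (((m : ℝ)⁻¹ : ℝ) : ℂ) * χ (m : ZMod q) := by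
  let f : ArithmeticFunction ℂ := ⟨fun d ↦ ((Λ d / d : ℝ) : ℂ) * χ (d : ZMod q), by simp⟩
  let g : ArithmeticFunction ℂ := ⟨fun m ↦ (((m : ℝ)⁻¹ : ℝ) : ℂ) * χ (m : ZMod q), by simp⟩
  refine Eq.trans (sum_congr rfl fun n hn ↦ ?_) (ArithmeticFunction.sum_Ioc_mul_eq_sum_sum f g N)
  have hn0 : n ≠ 0 := (mem_Ioc.1 hn).1.ne'
  rw [ArithmeticFunction.mul_apply, ← ArithmeticFunction.vonMangoldt_sum,
    ← Nat.sum_divisorsAntidiagonal (fun i _ ↦ Λ i), sum_div, ofReal_sum, sum_mul]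
  refine sum_congr rfl fun x hx ↦ ?_
  obtain ⟨rfl, -⟩ := Nat.mem_divisorsAntidiagonal.1 hx
  simp only [f, g, ArithmeticFunction.coe_mk]
  push_cast
  rw [map_mul, div_eq_mul_inv, mul_inv]
  ring

/-- The estimate `∑_{n ≤ N} χ(n) Λ(n) / n = O(1)`. -/
lemma DirichletCharacter.exists_norm_sum_vonMangoldt_div_mul_le {q : ℕ} [NeZero q]
    {χ : DirichletCharacter ℂ q} (hχ : χ ≠ 1) :
    ∃ K, ∀ N, ‖∑ n ∈ range N, ((Λ n / n : ℝ) : ℂ) * χ (n : ZMod q)‖ ≤ K := by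
  obtain ⟨K, hK⟩ := exists_norm_sum_log_div_mul_le hχ
  have hK0 : 0 ≤ K := (norm_nonneg _).trans (hK 0)
  have hL : 0 < ‖LFunction χ 1‖ := norm_pos_iff.2 (LFunction_apply_one_ne_zero hχ)
  refine ⟨(K + 2 * q * (Real.log 4 + 4)) / ‖LFunction χ 1‖, fun N ↦ ?_⟩
  rw [le_div_iff₀ hL, mul_comm, ← norm_mul]
  rcases N with _ | N
  · have := Real.log_nonneg (show (1 : ℝ) ≤ 4 by norm_num)
    simp; positivity
  rw [← sum_Ioc_zero_eq_sum_range (by simp)]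
  set S := ∑ n ∈ Ioc 0 N, ((Λ n / n : ℝ) : ℂ) * χ (n : ZMod q) with hS
  set T := ∑ n ∈ Ioc 0 N, ((Real.log n / n : ℝ) : ℂ) * χ (n : ZMod q) with hT
  have hTK : ‖T‖ ≤ K := by
    rw [hT, sum_Ioc_zero_eq_sum_range (by simp)]
    exact hK _
  have hdiff : ‖LFunction χ 1 * S - T‖ ≤ 2 * q * (Real.log 4 + 4) := by
    rw [hT, sum_log_div_mul_eq, hS, mul_sum, ← sum_sub_distrib]
    have hterm : ∀ d ∈ Ioc 0 N, ‖LFunction χ 1 * (((Λ d / d : ℝ) : ℂ) * χ (d : ZMod q)) -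
        ((Λ d / d : ℝ) : ℂ) * χ (d : ZMod q) *
          ∑ m ∈ Ioc 0 (N / d), (((m : ℝ)⁻¹ : ℝ) : ℂ) * χ (m : ZMod q)‖
        ≤ 2 * q / N * Λ d := by
      intro d hd
      obtain ⟨hd0, hdN⟩ := mem_Ioc.1 hd
      have hd0' : (0 : ℝ) < d := mod_cast hd0
      have hN0 : (0 : ℝ) < N := mod_cast hd0.trans_le hdN
      rw [mul_comm, ← mul_sub, norm_mul, norm_mul, norm_real,
        Real.norm_of_nonneg (div_nonneg ArithmeticFunction.vonMangoldt_nonneg hd0'.le),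
        sum_Ioc_zero_eq_sum_range (by simp)]
      have h1 := norm_LFunction_one_sub_sum_le hχ (M := N / d + 1) (by lia)
      have h2 : ((N / d + 1 : ℕ) : ℝ)⁻¹ ≤ d / N := by
        rw [inv_le_comm₀ (by positivity) (by positivity), inv_div, div_le_iff₀ hd0']
        exact_mod_cast (Nat.lt_div_mul_add hd0 (a := N)).le.trans (by lia)
      calc Λ d / d * ‖χ (d : ZMod q)‖ * _ ≤ Λ d / d * 1 * (2 * q * (d / N)) := by
            have := ArithmeticFunction.vonMangoldt_nonneg (n := d)
            gcongr
            · exact χ.norm_le_one _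
            · exact h1.trans (by gcongr)
        _ = 2 * q / N * Λ d := by field_simp
    refine (norm_sum_le_of_le _ hterm).trans ?_
    rw [← mul_sum]
    have hpsi := Chebyshev.psi_le_const_mul_self (x := N) (by positivity)
    rw [Chebyshev.psi, Nat.floor_natCast] at hpsi
    rcases Nat.eq_zero_or_pos N with rfl | hN
    · have := Real.log_nonneg (show (1 : ℝ) ≤ 4 by norm_num)
      simp; positivity
    have hN0 : (0 : ℝ) < N := mod_cast hN
    calc _ ≤ 2 * q / N * ((Real.log 4 + 4) * N) := by gcongr
      _ = _ := by field_simp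
  have := norm_add_le (LFunction χ 1 * S - T) T
  rw [sub_add_cancel] at this
  linarith

lemma summable_vonMangoldt_div_non_prime :
    Summable fun n : ℕ ↦ (if n.Prime then 0 else Λ n) / n := by
  refine (ArithmeticFunction.vonMangoldt.summable_residueClass_non_primes_div
    (0 : ZMod 1)).congr fun n ↦ ?_
  have : (n : ZMod 1) = 0 := Subsingleton.elim _ _
  simp [ArithmeticFunction.vonMangoldt.residueClass, this]

/-- The estimate `∑_{p < N} χ(p) log p / p = O(1)`. -/
lemma DirichletCharacter.exists_norm_sum_prime_log_div_mul_le {q : ℕ} [NeZero q]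
    {χ : DirichletCharacter ℂ q} (hχ : χ ≠ 1) :
    ∃ K, ∀ N, ‖∑ n ∈ range N,
      (if n.Prime then ((Real.log n / n : ℝ) : ℂ) * χ (n : ZMod q) else 0)‖ ≤ K := by
  obtain ⟨K, hK⟩ := exists_norm_sum_vonMangoldt_div_mul_le hχ
  refine ⟨K + ∑' n : ℕ, (if n.Prime then 0 else Λ n) / n, fun N ↦ ?_⟩
  have hnn : ∀ n : ℕ, 0 ≤ (if n.Prime then 0 else Λ n) / n := fun n ↦ by
    have := ArithmeticFunction.vonMangoldt_nonneg (n := n)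
    positivity
  have h1 : ∑ n ∈ range N, (if n.Prime then ((Real.log n / n : ℝ) : ℂ) * χ (n : ZMod q) else 0)
      = ∑ n ∈ range N, ((Λ n / n : ℝ) : ℂ) * χ (n : ZMod q)
        - ∑ n ∈ range N, (((if n.Prime then 0 else Λ n) / n : ℝ) : ℂ) * χ (n : ZMod q) := by
    rw [← sum_sub_distrib]
    refine sum_congr rfl fun n _ ↦ ?_
    split_ifs with hp
    · simp [ArithmeticFunction.vonMangoldt_apply_prime hp]
    · simp
  rw [h1]
  refine (norm_sub_le _ _).trans (add_le_add (hK N) ?_)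
  refine le_trans ?_ (summable_vonMangoldt_div_non_prime.sum_le_tsum (range N) fun n _ ↦ hnn n)
  refine norm_sum_le_of_le _ fun n _ ↦ ?_
  rw [norm_mul, norm_real, Real.norm_of_nonneg (hnn n)]
  exact mul_le_of_le_one_right (hnn n) (χ.norm_le_one _)

/-- The Euler product of a nonprincipal `L`-function converges at `s = 1`. -/
lemma DirichletCharacter.tendsto_prod_primesBelow_LFunction_one {q : ℕ} [NeZero q]
    {χ : DirichletCharacter ℂ q} (hχ : χ ≠ 1) :
    Tendsto (fun N : ℕ ↦ ∏ p ∈ N.primesBelow, (1 - χ (p : ZMod q) / p)⁻¹) atTop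
      (nhds (LFunction χ 1)) := by
  obtain ⟨K, hK⟩ := exists_norm_sum_prime_log_div_mul_le hχ
  set z : ℕ → ℝ → ℂ := fun n ε ↦ (((n : ℝ) ^ (-(1 + ε)) : ℝ) : ℂ) * χ (n : ZMod q) with hz
  have hzc (n : ℕ) : ContinuousOn (z n) (Set.Ici 0) :=
    (continuous_ofReal.comp_continuousOn (continuousOn_natCast_rpow_neg_one_add n)).mul
      continuousOn_const
  have hzn {n : ℕ} (hn : n.Prime) {ε : ℝ} (hε : 0 ≤ ε) : ‖z n ε‖ ≤ (n : ℝ)⁻¹ := by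
    rw [hz, norm_mul, norm_real, Real.norm_of_nonneg (by positivity)]
    exact (mul_le_of_le_one_right (by positivity) (χ.norm_le_one _)).trans
      (natCast_rpow_neg_one_add_le hε hn.one_le)
  have hinv {n : ℕ} (hn : n.Prime) : (n : ℝ)⁻¹ ≤ 1 / 2 := by
    rw [one_div]
    exact inv_anti₀ two_pos (mod_cast hn.two_le)
  have hU := uniformCauchySeqOn_sum_mul_of_antitone (s := Set.Ici (0 : ℝ)) hK
    (w := fun ε n ↦ (n : ℝ) ^ (-ε) * (Real.log n)⁻¹) (W := fun n ↦ (Real.log n)⁻¹) 2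
    (fun ε hε n hn ↦ by
      have h1 : (1 : ℝ) < n := mod_cast hn
      have h2 : 0 < Real.log n := Real.log_pos h1
      have h3 : Real.log n ≤ Real.log (n + 1 : ℕ) :=
        Real.log_le_log (by linarith) (by simp)
      have h4 : ((n + 1 : ℕ) : ℝ) ^ (-ε) ≤ (n : ℝ) ^ (-ε) :=
        Real.rpow_le_rpow_of_nonpos (by linarith) (by simp) (neg_nonpos.2 hε)
      gcongr)
    (fun ε hε n hn ↦ mul_nonneg (by positivity) (inv_nonneg.2 (Real.log_natCast_nonneg n)))
    (fun ε hε n hn ↦ mul_le_of_le_one_left (inv_nonneg.2 (Real.log_natCast_nonneg n))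
      (Real.rpow_le_one_of_one_le_of_nonpos (by exact_mod_cast (by lia : 1 ≤ n))
        (neg_nonpos.2 hε)))
    ((Real.tendsto_log_atTop.comp tendsto_natCast_atTop_atTop).inv_tendsto_atTop)
  have hF : ∀ N : ℕ, ∀ ε ∈ Set.Ici (0 : ℝ),
      ∑ n ∈ range N, (((n : ℝ) ^ (-ε) * (Real.log n)⁻¹ : ℝ) : ℂ) *
        (if n.Prime then ((Real.log n / n : ℝ) : ℂ) * χ (n : ZMod q) else 0) =
      ∑ n ∈ range N, if n.Prime then z n ε else 0 := by
    intro N ε _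
    refine sum_congr rfl fun n _ ↦ ?_
    split_ifs with hp
    · have hlog : Real.log n ≠ 0 := (Real.log_pos (mod_cast hp.one_lt)).ne'
      have hn0 : (0 : ℝ) < n := mod_cast hp.pos
      rw [← mul_assoc, ← ofReal_mul, hz]
      congr 2
      rw [neg_add, Real.rpow_add hn0, Real.rpow_neg_one]
      field_simp
    · simp
  obtain ⟨f, hfc, hf⟩ := hU.exists_continuousOn_limit fun N ↦ by
    refine (continuousOn_finsetSum _ fun n _ ↦ ?_).congr (hF N)
    split_ifs
    exacts [hzc n, continuousOn_const]
  have hslit {n : ℕ} (hn : n.Prime) {ε : ℝ} (hε : 0 ≤ ε) : 1 - z n ε ∈ slitPlane := by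
    rw [sub_eq_add_neg]
    refine mem_slitPlane_of_norm_lt_one ?_
    rw [norm_neg]
    linarith [hzn hn hε, hinv hn]
  set r : ℕ → ℝ → ℂ := fun n ε ↦ if n.Prime then -log (1 - z n ε) - z n ε else 0 with hr
  have hrc (n : ℕ) : ContinuousOn (r n) (Set.Ici 0) := by
    by_cases hp : n.Prime
    · simp only [hr, if_pos hp]
      exact (((continuousOn_const.sub (hzc n)).clog fun ε hε ↦ hslit hp hε).neg).sub (hzc n)
    · simpa only [hr, if_neg hp] using continuousOn_const
  have hrn (n : ℕ) (ε : ℝ) (hε : ε ∈ Set.Ici (0 : ℝ)) : ‖r n ε‖ ≤ 1 / (n : ℝ) ^ 2 := by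
    by_cases hp : n.Prime
    · have h1 := hzn hp hε
      have h2 : ‖z n ε‖ ≤ 1 / 2 := h1.trans (hinv hp)
      have h3 := norm_log_one_add_sub_self_le (z := -z n ε) (by rw [norm_neg]; linarith)
      simp only [hr, if_pos hp]
      rw [norm_neg] at h3
      have h4 : (1 - ‖z n ε‖)⁻¹ ≤ 2 := by
        rw [inv_le_comm₀ (by linarith) two_pos]
        linarith
      calc ‖-log (1 - z n ε) - z n ε‖ = ‖log (1 + -z n ε) - -z n ε‖ := by
            rw [← norm_neg]; congr 1; ring_nf
        _ ≤ ‖z n ε‖ ^ 2 * 2 / 2 := h3.trans (by gcongr)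
        _ = ‖z n ε‖ ^ 2 := by ring
        _ ≤ ((n : ℝ)⁻¹) ^ 2 := by gcongr
        _ = 1 / (n : ℝ) ^ 2 := by rw [inv_pow, one_div]
    · simp only [hr, if_neg hp, norm_zero]
      positivity
  have hR := tendstoUniformlyOn_tsum_nat (Real.summable_one_div_nat_pow.2 one_lt_two) hrn
  have hgc := hfc.add (hR.continuousOn (Frequently.of_forall
    fun N ↦ continuousOn_finsetSum _ fun n _ ↦ hrc n))
  set g : ℝ → ℂ := fun ε ↦ f ε + ∑' n, r n ε with hg
  have hprod : ∀ ε ∈ Set.Ici (0 : ℝ),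
      Tendsto (fun N : ℕ ↦ ∏ p ∈ N.primesBelow, (1 - z p ε)⁻¹) atTop (nhds (exp (g ε))) := by
    intro ε hε
    refine ((((hf.tendsto_at hε).congr fun N ↦ hF N ε hε).add (hR.tendsto_at hε)).cexp).congr fun N ↦ ?_
    rw [← sum_add_distrib, exp_sum, Nat.primesBelow, prod_filter]
    refine prod_congr rfl fun n _ ↦ ?_
    simp only [hr]
    split_ifs with hp
    · rw [add_sub_cancel, exp_neg, exp_log (slitPlane_ne_zero (hslit hp hε))]
    · simp
  have hpos : ∀ ε : ℝ, 0 < ε → exp (g ε) = LFunction χ (1 + ε) := fun ε hε ↦ by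
    have h1 : 1 < (1 + ε : ℂ).re := by simpa using hε
    refine tendsto_nhds_unique (hprod ε hε.le) ?_
    rw [LFunction_eq_LSeries χ h1]
    refine (LSeries_eulerProduct χ h1).congr fun N ↦ prod_congr rfl fun n _ ↦ ?_
    simp only [hz, ofReal_natCast_rpow]
    push_cast
    rw [mul_comm]
  have h0 : exp (g 0) = LFunction χ 1 := by
    refine tendsto_nhds_unique (((hgc.cexp 0 Set.self_mem_Ici).tendsto).mono_left
      (nhdsWithin_mono _ Set.Ioi_subset_Ici_self)) ?_
    exact (tendsto_LFunction_one_add hχ).congr'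
      (eventually_nhdsWithin_of_forall fun ε hε ↦ (hpos ε hε).symm)
  rw [← h0]
  refine (hprod 0 Set.self_mem_Ici).congr fun N ↦ prod_congr rfl fun n _ ↦ ?_
  simp only [hz, add_zero, Real.rpow_neg_one]
  push_cast
  rw [div_eq_mul_inv, mul_comm]

/-- The generating function of `|1 + z + ⋯ + z ^ m|²` for `z` on the unit circle. -/
lemma tsum_normSq_geom_sum_mul_pow {z : ℂ} (hz : ‖z‖ = 1) {x : ℝ} (hx0 : 0 ≤ x) (hx1 : x < 1) :
    (1 - x : ℂ) ^ 2 * ∑' m : ℕ, ((‖∑ i ∈ range (m + 1), z ^ i‖ ^ 2 : ℝ) : ℂ) * (x : ℂ) ^ m =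
      ((1 - x ^ 2) * ‖(1 - z * x)⁻¹‖ ^ 2 : ℝ) := by
  set w : ℂ := (starRingEnd ℂ) z with hw
  have hzw : z * w = 1 := by rw [hw, mul_conj, normSq_eq_norm_sq, hz]; simp
  have hwn : ‖w‖ = 1 := by rw [hw, norm_conj, hz]
  have hxn : ‖(x : ℂ)‖ = x := by rw [norm_real, Real.norm_of_nonneg hx0]
  have hsq (u : ℂ) : ((‖u‖ ^ 2 : ℝ) : ℂ) = u * (starRingEnd ℂ) u := by
    rw [mul_conj, normSq_eq_norm_sq]
  have hx' : (1 - x : ℂ) ≠ 0 := by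
    rw [← ofReal_one, ← ofReal_sub, ofReal_ne_zero]
    linarith
  have hne {y : ℂ} (hy : ‖y‖ = 1) : 1 - y * x ≠ 0 := fun h ↦ by
    have := congrArg norm (sub_eq_zero.1 h)
    rw [norm_mul, hy, hxn, norm_one] at this
    linarith
  have hbound {y : ℂ} (hy : ‖y‖ = 1) (m : ℕ) : ‖∑ i ∈ range (m + 1), y ^ i‖ ≤ m + 1 := by
    refine (norm_sum_le_of_le _ fun i _ ↦ (?_ : ‖y ^ i‖ ≤ 1)).trans (by simp)
    rw [norm_pow, hy, one_pow]
  have hg := summable_geometric_of_lt_one hx0 hx1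
  have hg1 := summable_pow_mul_geometric_of_norm_lt_one (R := ℝ) 1 (r := x)
    (by rwa [Real.norm_of_nonneg hx0])
  have hg2 := summable_pow_mul_geometric_of_norm_lt_one (R := ℝ) 2 (r := x)
    (by rwa [Real.norm_of_nonneg hx0])
  have hsA {y : ℂ} (hy : ‖y‖ = 1) :
      Summable fun m : ℕ ↦ (∑ i ∈ range (m + 1), y ^ i) * (x : ℂ) ^ m := by
    refine Summable.of_norm_bounded (hg1.add hg) fun m ↦ ?_
    rw [norm_mul, norm_pow, hxn]
    calc _ ≤ ((m : ℝ) + 1) * x ^ m := by gcongr; exact hbound hy m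
      _ = _ := by ring
  have hsS : Summable fun m : ℕ ↦
      ((∑ i ∈ range (m + 1), z ^ i) * ∑ i ∈ range (m + 1), w ^ i) * (x : ℂ) ^ m := by
    refine Summable.of_norm_bounded ((hg2.add (hg1.mul_left 2)).add hg) fun m ↦ ?_
    rw [norm_mul, norm_mul, norm_pow, hxn]
    calc _ ≤ (((m : ℝ) + 1) * (m + 1)) * x ^ m := by
          gcongr
          exacts [hbound hz m, hbound hwn m]
      _ = _ := by ring
  have hgC : HasSum (fun m : ℕ ↦ (x : ℂ) ^ m) (1 - x : ℂ)⁻¹ :=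
    hasSum_geometric_of_norm_lt_one (by rwa [hxn])
  have hA {y : ℂ} (hy : ‖y‖ = 1) :
      (∑' m : ℕ, (∑ i ∈ range (m + 1), y ^ i) * (x : ℂ) ^ m) * (1 - y * x) = (1 - x : ℂ)⁻¹ := by
    have h1 := (hsA hy).tsum_eq_zero_add
    have h2 : ∀ m : ℕ, (∑ i ∈ range (m + 1 + 1), y ^ i) * (x : ℂ) ^ (m + 1) =
        x * x ^ m + y * x * ((∑ i ∈ range (m + 1), y ^ i) * (x : ℂ) ^ m) := fun m ↦ by
      rw [geom_sum_succ (n := m + 1)]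
      ring
    rw [tsum_congr h2, ((hgC.summable.mul_left (x : ℂ))).tsum_add ((hsA hy).mul_left _),
      tsum_mul_left, tsum_mul_left, hgC.tsum_eq] at h1
    simp only [zero_add, range_one, sum_singleton, pow_zero, mul_one] at h1
    have h3 : (1 - x : ℂ)⁻¹ = 1 + x * (1 - x : ℂ)⁻¹ := by field_simp; ring
    linear_combination h1 - h3
  have hS := hsS.tsum_eq_zero_add
  have h2 : ∀ m : ℕ, ((∑ i ∈ range (m + 1 + 1), z ^ i) * ∑ i ∈ range (m + 1 + 1), w ^ i)
        * (x : ℂ) ^ (m + 1) =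
      (x * x ^ m + z * x * ((∑ i ∈ range (m + 1), z ^ i) * (x : ℂ) ^ m)) +
      (w * x * ((∑ i ∈ range (m + 1), w ^ i) * (x : ℂ) ^ m) +
        x * (((∑ i ∈ range (m + 1), z ^ i) * ∑ i ∈ range (m + 1), w ^ i) * (x : ℂ) ^ m)) :=
    fun m ↦ by
      rw [geom_sum_succ (n := m + 1), geom_sum_succ (n := m + 1)]
      linear_combination (x : ℂ) ^ (m + 1) * (∑ i ∈ range (m + 1), z ^ i) *
        (∑ i ∈ range (m + 1), w ^ i) * hzw
  rw [tsum_congr h2, (((hgC.summable.mul_left (x : ℂ))).add ((hsA hz).mul_left _)).tsum_add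
      (((hsA hwn).mul_left _).add (hsS.mul_left _)),
    ((hgC.summable.mul_left (x : ℂ))).tsum_add ((hsA hz).mul_left _),
    ((hsA hwn).mul_left _).tsum_add (hsS.mul_left _),
    tsum_mul_left, tsum_mul_left, tsum_mul_left, tsum_mul_left, hgC.tsum_eq,
    eq_div_of_mul_eq (hne hz) (hA hz), eq_div_of_mul_eq (hne hwn) (hA hwn)] at hS
  simp only [zero_add, range_one, sum_singleton, pow_zero, mul_one] at hS
  have hconj : (starRingEnd ℂ) (1 - z * x) = 1 - w * x := by simp [hw]
  have hlhs : ∀ m : ℕ, ((‖∑ i ∈ range (m + 1), z ^ i‖ ^ 2 : ℝ) : ℂ) * (x : ℂ) ^ m =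
      ((∑ i ∈ range (m + 1), z ^ i) * ∑ i ∈ range (m + 1), w ^ i) * (x : ℂ) ^ m := fun m ↦ by
    rw [hsq, map_sum]
    simp [hw]
  rw [tsum_congr hlhs, ofReal_mul, hsq, map_inv₀, hconj]
  generalize (∑' m : ℕ, ((∑ i ∈ range (m + 1), z ^ i) * ∑ i ∈ range (m + 1), w ^ i)
    * (x : ℂ) ^ m) = S at hS ⊢
  rw [div_eq_mul_inv, div_eq_mul_inv] at hS
  have hc := mul_inv_cancel₀ hx'
  have ha := mul_inv_cancel₀ (hne hz)
  have hb := mul_inv_cancel₀ (hne hwn)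
  push_cast
  generalize (1 - x : ℂ)⁻¹ = c at hS hc ⊢
  generalize (1 - z * x : ℂ)⁻¹ = a at hS ha ⊢
  generalize (1 - w * x : ℂ)⁻¹ = b at hS hb ⊢
  have hS' : (1 - x) ^ 2 * S = 1 + z * x * a + w * x * b := by
    linear_combination (1 - x : ℂ) * hS + (x + z * x * a + w * x * b) * hc
  have hab : (x : ℂ) ^ 2 * a * b = (a - 1) * (b - 1) := by
    linear_combination (-(x : ℂ) ^ 2 * a * b) * hzw - w * x * b * ha - (a - 1) * hb
  linear_combination hS' + hab - ha - hb

/-- The local factor of the product at a prime `p`. -/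
lemma local_factor_eq {q : ℕ} [NeZero q] (χ : DirichletCharacter ℂ q) {p : ℕ} (hp : p.Prime) :
    (((1 - 1 / (p : ℝ)) ^ 2 : ℝ) : ℂ) *
      ∑' m : ℕ, (1 : DirichletCharacter ℂ q) (((p ^ m : ℕ) : ℕ) : ZMod q) *
        ((‖∑ d ∈ (p ^ m : ℕ).divisors, χ ((d : ℕ) : ZMod q)‖ ^ 2 : ℝ) : ℂ) /
          (((p : ℝ) ^ m : ℝ) : ℂ) =
    (((1 - ((p : ℝ) ^ 2)⁻¹) * ‖(1 - χ (p : ZMod q) / p)⁻¹‖ ^ 2 *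
      (if p ∈ q.primeFactors then (1 - (p : ℝ)⁻¹) * (1 - 1 / ((p : ℝ) + 1)) else 1) : ℝ) : ℂ) := by
  have hp1 : (1 : ℝ) < p := mod_cast hp.one_lt
  by_cases hpq : p ∈ q.primeFactors
  · have hnu : ¬ IsUnit (p : ZMod q) := by
      rw [ZMod.isUnit_iff_coprime, hp.coprime_iff_not_dvd, not_not]
      exact Nat.dvd_of_mem_primeFactors hpq
    rw [tsum_eq_single 0, if_pos hpq, χ.map_nonunit hnu]
    · simp only [pow_zero, Nat.cast_one, map_one, Nat.divisors_one, sum_singleton, norm_one,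
        one_pow, ofReal_one, mul_one, div_one, zero_div, sub_zero, inv_one]
      congr 1
      field_simp
      ring
    · intro m hm
      have : ¬ IsUnit ((p ^ m : ℕ) : ZMod q) := by
        rw [Nat.cast_pow, isUnit_pow_iff hm]
        exact hnu
      rw [MulChar.map_nonunit _ this]
      simp
  · have hu : IsUnit (p : ZMod q) := by
      rw [ZMod.isUnit_iff_coprime, hp.coprime_iff_not_dvd]
      exact fun h ↦ hpq (Nat.mem_primeFactors.2 ⟨hp, h, NeZero.ne q⟩)
    have hz : ‖χ (p : ZMod q)‖ = 1 := by
      simpa using χ.unit_norm_eq_one hu.unit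
    have h := tsum_normSq_geom_sum_mul_pow hz (x := (p : ℝ)⁻¹) (by positivity) (inv_lt_one_of_one_lt₀ hp1)
    rw [if_neg hpq, mul_one]
    convert h using 2
    · push_cast
      rw [one_div]
    · refine tsum_congr fun m ↦ ?_
      rw [MulChar.one_apply (by rw [Nat.cast_pow]; exact hu.pow m), one_mul,
        Nat.sum_divisors_prime_pow hp, div_eq_mul_inv]
      simp
    · simp [div_eq_mul_inv]

lemma tendsto_prod_primesBelow_one_sub_sq_inv :
    Tendsto (fun N : ℕ ↦ ∏ p ∈ N.primesBelow, (1 - ((p : ℝ) ^ 2)⁻¹)) atTop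
      (nhds (6 / π ^ 2)) := by
  have h := (riemannZeta_eulerProduct (s := 2) (by simp)).inv₀
    (riemannZeta_ne_zero_of_one_le_re (by simp))
  rw [riemannZeta_two, inv_div] at h
  have h' := (continuous_re.tendsto _).comp h
  have e : ((6 : ℂ) / π ^ 2).re = 6 / π ^ 2 := by
    rw [← ofReal_re (6 / π ^ 2)]
    push_cast
    rfl
  rw [e] at h'
  refine h'.congr fun N ↦ ?_
  rw [Function.comp_apply, ← ofReal_re (∏ p ∈ N.primesBelow, _), ← prod_inv_distrib]
  push_cast
  congr 2
  funext p
  rw [inv_inv, cpow_neg]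
  norm_num

lemma primesUpTo_natCast (Y : ℕ) : primesUpTo (Y : ℝ) = (Y + 1).primesBelow := by
  ext p
  simp only [primesUpTo, Nat.primesBelow, Nat.floor_natCast, mem_filter, mem_range, Nat.cast_le]
  lia

lemma totient_div_eq_prod (q : ℕ) [NeZero q] :
    (q.totient : ℝ) / q = ∏ p ∈ q.primeFactors, (1 - (p : ℝ)⁻¹) := by
  rw [div_eq_iff (NeZero.ne _), mul_comm]
  simpa using congrArg (fun x : ℚ ↦ (x : ℝ)) q.totient_eq_mul_prod_factors

/-- For a non-principal character `χ` modulo `q`, the Euler product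
`∏_p (1−1/p)² Σ_m χ₀(p^m)|(1*χ)(p^m)|²/p^m` converges (as a limit of partial products over
`p ≤ Y`) and equals `(6/π²)|L(1,χ)|²(φ(q)/q) ∏_{p ∣ q} (1 − 1/(p+1))`. -/
theorem euler_product_limit_principal_times_chi (q : ℕ) [NeZero q]
    (χ : DirichletCharacter ℂ q) (hχ : χ ≠ 1) :
    ∃ Pi : ℂ,
      Tendsto (fun Y : ℕ => ∏ p ∈ primesUpTo (Y : ℝ),
          ((((1 - 1 / (p : ℝ)) ^ 2 : ℝ) : ℂ) *
            ∑' m : ℕ, (1 : DirichletCharacter ℂ q) (((p ^ m : ℕ) : ℕ) : ZMod q) *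
              ((‖∑ d ∈ (p ^ m : ℕ).divisors, χ ((d : ℕ) : ZMod q)‖ ^ 2 : ℝ) : ℂ) /
                (((p : ℝ) ^ m : ℝ) : ℂ)))
        atTop (nhds Pi) ∧
      Pi = (((6 / π ^ 2) * ‖DirichletCharacter.LFunction χ 1‖ ^ 2 *
              ((q.totient : ℝ) / (q : ℝ)) *
              ∏ p ∈ q.primeFactors, (1 - 1 / ((p : ℝ) + 1)) : ℝ) : ℂ) := by
  simp only [primesUpTo_natCast]
  refine ⟨_, ?_, rfl⟩
  have hfin : ∀ᶠ N : ℕ in atTop, ∏ p ∈ (N + 1).primesBelow, (if p ∈ q.primeFactors then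
      (1 - (p : ℝ)⁻¹) * (1 - 1 / ((p : ℝ) + 1)) else 1) =
      ∏ p ∈ q.primeFactors, (1 - (p : ℝ)⁻¹) * (1 - 1 / ((p : ℝ) + 1)) := by
    filter_upwards [eventually_ge_atTop q] with N hN
    rw [← prod_filter]
    refine prod_congr ?_ fun _ _ ↦ rfl
    ext p
    simp only [mem_filter, Nat.mem_primesBelow, and_iff_right_iff_imp]
    intro hp
    exact ⟨Nat.lt_succ_of_le ((Nat.le_of_mem_primeFactors hp).trans hN),
      Nat.prime_of_mem_primeFactors hp⟩
  have h1 := tendsto_prod_primesBelow_one_sub_sq_inv.comp (tendsto_add_atTop_nat 1)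
  have h2 := ((DirichletCharacter.tendsto_prod_primesBelow_LFunction_one hχ).norm.pow 2).comp
    (tendsto_add_atTop_nat 1)
  have h3 := (h1.mul h2).mul (tendsto_const_nhds.congr' (hfin.mono fun _ h ↦ h.symm))
  rw [totient_div_eq_prod, mul_assoc _ (∏ p ∈ q.primeFactors, (1 - (p : ℝ)⁻¹)),
    ← prod_mul_distrib]
  refine ((continuous_ofReal.tendsto _).comp h3).congr fun N ↦ ?_
  rw [prod_congr rfl fun p hp ↦ local_factor_eq χ (Nat.prime_of_mem_primesBelow hp),
    ← ofReal_prod, prod_mul_distrib, prod_mul_distrib]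
  simp only [Function.comp_apply, norm_prod, prod_pow]
end

section
/- Let ℓ be a tuple of nonnegative integers indexed by the Dirichlet characters modulo q with |ℓ| = k, and let X > q². Let β_ℓ(n) be the coefficient of n^{−s} in the Dirichlet series of 𝓟*_X^ℓ(s); β_ℓ is multiplicative and supported on 𝒮_q(X). Then Σ_{n ∈ 𝒮_q(X)} |β_ℓ(n)|²/n = (1 + E) · ∏_{p ≤ X, p ∤ q} [Σ_{m=0}^∞ |d_ℓ(p^m)|²/p^m], where |E| ≤ C·X^{−1/2}/log X for a constant C depending only on k. -/
open Complex Filter MeasureTheory Finset HurwitzZeta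
open scoped ArithmeticFunction Real Classical

section PowerSeriesEvaluation

open PowerSeries

/-- The power series `F` converges absolutely at `z` to the value `v`. -/
def EvaluatesTo (F : PowerSeries ℂ) (z v : ℂ) : Prop :=
  Summable (fun m : ℕ => ‖coeff m F * z ^ m‖) ∧ ∑' m : ℕ, coeff m F * z ^ m = v

lemma EvaluatesTo.one (z : ℂ) : EvaluatesTo 1 z 1 := by
  have h : (fun m : ℕ => coeff m (1 : PowerSeries ℂ) * z ^ m) = Pi.single 0 1 := by
    funext m
    rcases eq_or_ne m 0 with rfl | hm
    · simp
    · simp [coeff_one, hm]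
  have h2 : ∀ m ∉ ({0} : Finset ℕ), ‖coeff m (1 : PowerSeries ℂ) * z ^ m‖ = 0 := by
    intro m hm
    rw [congrFun h m, Pi.single_eq_of_ne (by simpa using hm), norm_zero]
  exact ⟨summable_of_ne_finset_zero h2, h ▸ tsum_pi_single (0 : ℕ) (1 : ℂ)⟩

lemma EvaluatesTo.mul {F G : PowerSeries ℂ} {z v w : ℂ} (hF : EvaluatesTo F z v)
    (hG : EvaluatesTo G z w) : EvaluatesTo (F * G) z (v * w) := by
  have key : ∀ m : ℕ, coeff m (F * G) * z ^ m =
      ∑ kl ∈ antidiagonal m, (coeff kl.1 F * z ^ kl.1) * (coeff kl.2 G * z ^ kl.2) := by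
    intro m
    rw [coeff_mul, Finset.sum_mul]
    refine Finset.sum_congr rfl fun kl hkl => ?_
    rw [← mem_antidiagonal.mp hkl, pow_add]
    ring
  set f : ℕ → ℂ := fun m => coeff m F * z ^ m
  set g : ℕ → ℂ := fun m => coeff m G * z ^ m
  have hf : Summable fun m => ‖f m‖ := hF.1
  have hg : Summable fun m => ‖g m‖ := hG.1
  have hfv : ∑' m, f m = v := hF.2
  have hgw : ∑' m, g m = w := hG.2
  have h := tsum_mul_tsum_eq_tsum_sum_antidiagonal_of_summable_norm hf hg
  rw [hfv, hgw] at h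
  refine ⟨?_, ?_⟩
  · refine (summable_norm_sum_mul_antidiagonal_of_summable_norm hf hg).congr fun m => ?_
    rw [key m]
  · rw [h]
    exact tsum_congr key

lemma EvaluatesTo.pow {F : PowerSeries ℂ} {z v : ℂ} (hF : EvaluatesTo F z v) (n : ℕ) :
    EvaluatesTo (F ^ n) z (v ^ n) := by
  induction n with
  | zero => simpa using EvaluatesTo.one z
  | succ n ih => simpa [pow_succ] using ih.mul hF

lemma EvaluatesTo.prod {ι : Type*} (s : Finset ι) {F : ι → PowerSeries ℂ} {z : ℂ} {v : ι → ℂ}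
    (h : ∀ i ∈ s, EvaluatesTo (F i) z (v i)) :
    EvaluatesTo (∏ i ∈ s, F i) z (∏ i ∈ s, v i) := by
  induction s using Finset.induction_on with
  | empty => simpa using EvaluatesTo.one z
  | insert a s ha ih =>
    rw [Finset.prod_insert ha, Finset.prod_insert ha]
    exact (h a (by simp)).mul (ih fun i hi => h i (by simp [hi]))

/-- The geometric series `∑ c ^ m z ^ m`. -/
noncomputable def geomSeries (c : ℂ) : PowerSeries ℂ := PowerSeries.mk fun m => c ^ m

lemma evaluatesTo_geomSeries {c z : ℂ} (h : ‖c * z‖ < 1) :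
    EvaluatesTo (geomSeries c) z (1 - c * z)⁻¹ := by
  have key : ∀ m : ℕ, coeff m (geomSeries c) * z ^ m = (c * z) ^ m := by
    intro m
    simp [geomSeries, mul_pow]
  refine ⟨?_, ?_⟩
  · simp_rw [key]
    exact (summable_geometric_of_norm_lt_one h).norm
  · simp_rw [key]
    exact tsum_geometric_of_norm_lt_one h

/-- The coefficients of `F` are bounded by those of `(1 - z) ^ (-N)`. -/
def MajorizedBy (F : PowerSeries ℂ) (N : ℕ) : Prop :=
  ∀ m : ℕ, ‖coeff m F‖ ≤ coeff m ((PowerSeries.mk 1 : PowerSeries ℝ) ^ N)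

lemma coeff_mk_one_pow_nonneg (N m : ℕ) :
    0 ≤ coeff m ((PowerSeries.mk 1 : PowerSeries ℝ) ^ N) := by
  induction N generalizing m with
  | zero =>
    rw [pow_zero, coeff_one]
    split_ifs <;> simp
  | succ N ih =>
    rw [pow_succ, coeff_mul]
    exact Finset.sum_nonneg fun kl _ => mul_nonneg (ih _) (by simp)

lemma MajorizedBy.one : MajorizedBy 1 0 := by
  intro m
  rw [pow_zero, coeff_one, coeff_one]
  split_ifs <;> simp

lemma MajorizedBy.mul {F G : PowerSeries ℂ} {M N : ℕ} (hF : MajorizedBy F M)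
    (hG : MajorizedBy G N) : MajorizedBy (F * G) (M + N) := by
  intro m
  rw [pow_add, coeff_mul, coeff_mul]
  refine (norm_sum_le _ _).trans (Finset.sum_le_sum fun kl _ => ?_)
  rw [norm_mul]
  exact mul_le_mul (hF _) (hG _) (norm_nonneg _) (coeff_mk_one_pow_nonneg _ _)

lemma MajorizedBy.pow {F : PowerSeries ℂ} {N : ℕ} (hF : MajorizedBy F N) (n : ℕ) :
    MajorizedBy (F ^ n) (N * n) := by
  induction n with
  | zero => simpa using MajorizedBy.one
  | succ n ih => simpa [pow_succ, mul_add] using ih.mul hF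

lemma MajorizedBy.prod {ι : Type*} (s : Finset ι) {F : ι → PowerSeries ℂ} {N : ι → ℕ}
    (h : ∀ i ∈ s, MajorizedBy (F i) (N i)) :
    MajorizedBy (∏ i ∈ s, F i) (∑ i ∈ s, N i) := by
  induction s using Finset.induction_on with
  | empty => simpa using MajorizedBy.one
  | insert a s ha ih =>
    rw [Finset.prod_insert ha, Finset.sum_insert ha]
    exact (h a (by simp)).mul (ih fun i hi => h i (by simp [hi]))

lemma majorizedBy_geomSeries {c : ℂ} (h : ‖c‖ ≤ 1) : MajorizedBy (geomSeries c) 1 := by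
  intro m
  simpa [geomSeries] using pow_le_one₀ (norm_nonneg c) h

lemma MajorizedBy.mono {F : PowerSeries ℂ} {M N : ℕ} (hF : MajorizedBy F M) (h : M ≤ N) :
    MajorizedBy F N := by
  have h1 : MajorizedBy 1 (N - M) := by
    intro m
    rcases eq_or_ne m 0 with rfl | hm
    · simp
    · simpa [coeff_one, hm] using coeff_mk_one_pow_nonneg _ _
  simpa [Nat.add_sub_cancel' h] using hF.mul h1

/-- `F ≡ 1` modulo `z ^ 2`. -/
def TrivialToFirstOrder (F : PowerSeries ℂ) : Prop := coeff 0 F = 1 ∧ coeff 1 F = 0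

lemma TrivialToFirstOrder.one : TrivialToFirstOrder 1 := by
  simp [TrivialToFirstOrder, coeff_one]

lemma coeff_one_mul_eq (F G : PowerSeries ℂ) :
    coeff 1 (F * G) = coeff 0 F * coeff 1 G + coeff 1 F * coeff 0 G := by
  rw [coeff_mul]
  simp [Finset.Nat.antidiagonal_succ]

lemma TrivialToFirstOrder.mul {F G : PowerSeries ℂ} (hF : TrivialToFirstOrder F)
    (hG : TrivialToFirstOrder G) : TrivialToFirstOrder (F * G) := by
  refine ⟨?_, ?_⟩
  · have hF0 := hF.1
    have hG0 := hG.1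
    simp_all
  · rw [coeff_one_mul_eq, hF.2, hG.2]
    simp

lemma TrivialToFirstOrder.pow {F : PowerSeries ℂ} (hF : TrivialToFirstOrder F) (n : ℕ) :
    TrivialToFirstOrder (F ^ n) := by
  induction n with
  | zero => simpa using TrivialToFirstOrder.one
  | succ n ih => simpa [pow_succ] using ih.mul hF

lemma TrivialToFirstOrder.mul_left_coeff {F G : PowerSeries ℂ} (hG : TrivialToFirstOrder G)
    {m : ℕ} (hm : m < 2) : coeff m (F * G) = coeff m F := by
  interval_cases m
  · have := hG.1
    simp_all
  · rw [coeff_one_mul_eq, hG.1, hG.2]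
    simp

/-- The sum `∑ B_m ^ 2 / 2 ^ m`, with `B_m` the coefficients of `(1 - z) ^ (-N)`, converges. -/
lemma summable_sq_coeff_mk_one_pow (N : ℕ) :
    Summable fun m : ℕ => (coeff m ((PowerSeries.mk 1 : PowerSeries ℝ) ^ N)) ^ 2 / 2 ^ m := by
  set r : ℝ := (√2)⁻¹ with hr
  have hr2 : r ^ 2 = 2⁻¹ := by rw [hr, inv_pow, Real.sq_sqrt (by norm_num)]
  have hr0 : 0 < r := by positivity
  have hr1 : r < 1 := by nlinarith
  have hmap : ∀ m : ℕ, coeff m (geomSeries 1 ^ N) =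
      ((coeff m ((PowerSeries.mk 1 : PowerSeries ℝ) ^ N) : ℝ) : ℂ) := by
    intro m
    have : geomSeries 1 = PowerSeries.map Complex.ofRealHom (PowerSeries.mk 1) := by
      ext m
      simp [geomSeries]
    rw [this, ← map_pow, PowerSeries.coeff_map]
    rfl
  have h := ((evaluatesTo_geomSeries (c := 1) (z := (r : ℂ))
    (by simpa [abs_of_pos hr0] using hr1)).pow N).1
  have h2 : Summable fun m : ℕ => ‖coeff m (geomSeries 1 ^ N) * (r : ℂ) ^ m‖ ^ 2 := by
    refine Summable.of_norm_bounded_eventually_nat h ?_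
    filter_upwards [h.tendsto_atTop_zero.eventually_le_const one_pos] with m hm
    rw [norm_pow, norm_norm, sq]
    exact mul_le_of_le_one_left (norm_nonneg _) hm
  refine h2.congr fun m => ?_
  rw [hmap, norm_mul, mul_pow, norm_pow, ← pow_mul, mul_comm m 2, pow_mul, Complex.norm_real,
    Complex.norm_real, Real.norm_eq_abs, Real.norm_eq_abs, sq_abs, sq_abs, hr2, inv_pow,
    div_eq_mul_inv]

end PowerSeriesEvaluation

section MultiplicativeFunctions

open PowerSeries

/-- The multiplicative function whose values at the powers of `p` are the coefficients of `F p`. -/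
noncomputable def mulOfLocal (F : ℕ → PowerSeries ℂ) (n : ℕ) : ℂ :=
  if n = 0 then 0 else n.factorization.prod fun p m => coeff m (F p)

variable {F : ℕ → PowerSeries ℂ}

lemma mulOfLocal_one : mulOfLocal F 1 = 1 := by simp [mulOfLocal]

lemma mulOfLocal_mul {m n : ℕ} (h : m.Coprime n) :
    mulOfLocal F (m * n) = mulOfLocal F m * mulOfLocal F n := by
  rcases eq_or_ne m 0 with rfl | hm
  · simp [mulOfLocal]
  rcases eq_or_ne n 0 with rfl | hn
  · simp [mulOfLocal]
  simp only [mulOfLocal, hm, hn, mul_eq_zero, or_self, if_false]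
  rw [Nat.factorization_mul_of_coprime h, Finsupp.prod_add_index_of_disjoint]
  exact h.disjoint_primeFactors

lemma mulOfLocal_prime_pow (hF : ∀ p, coeff 0 (F p) = 1) {p : ℕ} (hp : p.Prime) (m : ℕ) :
    mulOfLocal F (p ^ m) = coeff m (F p) := by
  have h : p ^ m ≠ 0 := pow_ne_zero _ hp.ne_zero
  rw [mulOfLocal, if_neg h, hp.factorization_pow, Finsupp.prod_single_index (hF p)]

lemma mulOfLocal_eq_zero {S : Finset ℕ} (hF : ∀ p ∉ S, F p = 1) {n : ℕ}
    (hn : n ∉ Nat.factoredNumbers S) : mulOfLocal F n = 0 := by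
  rcases eq_or_ne n 0 with rfl | h0
  · simp [mulOfLocal]
  rw [Nat.mem_factoredNumbers'] at hn
  push Not at hn
  obtain ⟨p, hp, hdvd, hpS⟩ := hn
  rw [mulOfLocal, if_neg h0]
  have hmem : p ∈ n.factorization.support := by
    rw [Nat.support_factorization]
    exact Nat.mem_primeFactors.mpr ⟨hp, hdvd, h0⟩
  refine Finset.prod_eq_zero hmem ?_
  simp only [hF p hpS]
  rw [coeff_one, if_neg (Finsupp.mem_support_iff.mp hmem)]

lemma natCast_pow_cpow (p m : ℕ) (s : ℂ) : ((p : ℂ) ^ m) ^ s = ((p : ℂ) ^ s) ^ m := by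
  induction m with
  | zero => simp
  | succ m ih =>
    rw [pow_succ, pow_succ, ← ih, ← Nat.cast_pow, Complex.natCast_mul_natCast_cpow]

lemma LSeries_mulOfLocal {S : Finset ℕ} (hF : ∀ p ∉ S, F p = 1) (hF0 : ∀ p, coeff 0 (F p) = 1)
    (hS : ∀ p ∈ S, p.Prime) {s : ℂ} {v : ℕ → ℂ}
    (hv : ∀ p ∈ S, EvaluatesTo (F p) ((p : ℂ) ^ (-s)) (v p)) :
    LSeriesSummable (mulOfLocal F) s ∧ LSeries (mulOfLocal F) s = ∏ p ∈ S, v p := by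
  set f : ℕ → ℂ := LSeries.term (mulOfLocal F) s with hf
  have hf1 : f 1 = 1 := by simp [hf, LSeries.term_of_ne_zero, mulOfLocal_one]
  have hmul : ∀ {m n : ℕ}, m.Coprime n → f (m * n) = f m * f n := by
    intro m n h
    rcases eq_or_ne m 0 with rfl | hm
    · simp [hf]
    rcases eq_or_ne n 0 with rfl | hn
    · simp [hf]
    simp only [hf]
    rw [LSeries.term_of_ne_zero hm, LSeries.term_of_ne_zero hn,
      LSeries.term_of_ne_zero (mul_ne_zero hm hn), mulOfLocal_mul h, Nat.cast_mul,
      Complex.natCast_mul_natCast_cpow, mul_div_mul_comm]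
  have hpow : ∀ {p : ℕ}, p.Prime → ∀ m : ℕ,
      f (p ^ m) = coeff m (F p) * ((p : ℂ) ^ (-s)) ^ m := by
    intro p hp m
    simp only [hf]
    rw [LSeries.term_of_ne_zero (pow_ne_zero _ hp.ne_zero), mulOfLocal_prime_pow hF0 hp,
      Complex.cpow_neg, inv_pow, div_eq_mul_inv, Nat.cast_pow, natCast_pow_cpow]
  have hev : ∀ {p : ℕ}, p.Prime → Summable fun m : ℕ => ‖f (p ^ m)‖ := by
    intro p hp
    simp_rw [hpow hp]
    by_cases h : p ∈ S
    · exact (hv p h).1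
    · rw [hF p h]
      exact (EvaluatesTo.one _).1
  obtain ⟨h1, h2⟩ := EulerProduct.summable_and_hasSum_factoredNumbers_prod_filter_prime_tsum
    hf1 hmul hev S
  have hsupp : Function.support f ⊆ (Nat.factoredNumbers S : Set ℕ) := by
    intro n hn
    by_contra h
    refine hn ?_
    simp only [hf]
    rw [LSeries.term_def, mulOfLocal_eq_zero hF h]
    simp
  have h3 := (hasSum_subtype_iff_of_support_subset hsupp).mp h2
  refine ⟨h3.summable, ?_⟩
  rw [LSeries, h3.tsum_eq, Finset.filter_true_of_mem hS]
  refine Finset.prod_congr rfl fun p hp => ?_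
  simp_rw [hpow (hS p hp)]
  exact (hv p hp).2

lemma tsum_norm_sq_mulOfLocal (hF0 : ∀ p, coeff 0 (F p) = 1) (S : Finset ℕ)
    (hS : ∀ p ∈ S, p.Prime)
    (hv : ∀ p : ℕ, p.Prime → Summable fun m : ℕ => ‖coeff m (F p)‖ ^ 2 / (p : ℝ) ^ m) :
    (∑' n : ℕ, if n ∈ Nat.factoredNumbers S then ‖mulOfLocal F n‖ ^ 2 / (n : ℝ) else 0) =
      ∏ p ∈ S, ∑' m : ℕ, ‖coeff m (F p)‖ ^ 2 / (p : ℝ) ^ m := by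
  set f : ℕ → ℝ := fun n => ‖mulOfLocal F n‖ ^ 2 / (n : ℝ) with hf
  have hf1 : f 1 = 1 := by simp [hf, mulOfLocal_one]
  have hmul : ∀ {m n : ℕ}, m.Coprime n → f (m * n) = f m * f n := by
    intro m n h
    simp only [hf]
    rw [mulOfLocal_mul h, norm_mul, Nat.cast_mul, mul_pow, mul_div_mul_comm]
  have hpow : ∀ {p : ℕ}, p.Prime → ∀ m : ℕ, f (p ^ m) = ‖coeff m (F p)‖ ^ 2 / (p : ℝ) ^ m := by
    intro p hp m
    simp only [hf]
    rw [mulOfLocal_prime_pow hF0 hp, Nat.cast_pow]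
  have hev : ∀ {p : ℕ}, p.Prime → Summable fun m : ℕ => ‖f (p ^ m)‖ := by
    intro p hp
    simp_rw [hpow hp]
    exact (hv p hp).norm
  obtain ⟨-, h2⟩ := EulerProduct.summable_and_hasSum_factoredNumbers_prod_filter_prime_tsum
    hf1 hmul hev S
  have h3 := tsum_subtype (Nat.factoredNumbers S) f
  rw [h2.tsum_eq, Finset.filter_true_of_mem hS] at h3
  calc _ = ∑' n, (Nat.factoredNumbers S).indicator f n := by
        refine tsum_congr fun n => ?_
        rw [Set.indicator_apply]
    _ = _ := by
        rw [← h3]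
        refine Finset.prod_congr rfl fun p hp => ?_
        simp_rw [hpow (hS p hp)]

/-- Restricting an arithmetic function to the powers of `p` turns Dirichlet convolution into
multiplication of power series. -/
noncomputable def restrictToPowers (p : ℕ) (hp : p.Prime) :
    ArithmeticFunction ℂ →* PowerSeries ℂ where
  toFun f := PowerSeries.mk fun m => f (p ^ m)
  map_one' := by
    ext m
    rw [coeff_mk, coeff_one, ArithmeticFunction.one_apply]
    simp [hp.ne_one]
  map_mul' f g := by
    ext m
    rw [coeff_mk, coeff_mul, ArithmeticFunction.mul_apply,
      Nat.sum_divisorsAntidiagonal fun x y => f x * g y]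
    rw [Nat.sum_divisors_prime_pow hp, Finset.Nat.sum_antidiagonal_eq_sum_range_succ_mk]
    refine Finset.sum_congr rfl fun i hi => ?_
    rw [coeff_mk, coeff_mk, Nat.pow_div (Nat.lt_succ_iff.mp (Finset.mem_range.mp hi)) hp.pos]

end MultiplicativeFunctions

section ChebyshevTail

/-- Partial summation against Chebyshev's bound for `θ`. -/
lemma sum_log_div_sq_le {M N : ℕ} (hM : 1 ≤ M) (hMN : M ≤ N) :
    ∑ p ∈ (Finset.Ioc M N).filter Nat.Prime, Real.log p / (p : ℝ) ^ 2
      ≤ Chebyshev.theta N / (N : ℝ) ^ 2 + 2 * Real.log 4 * (1 / (M : ℝ) - 1 / N) := by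
  induction N, hMN using Nat.le_induction with
  | base =>
    simp only [Finset.Ioc_self, Finset.filter_empty, Finset.sum_empty, sub_self, mul_zero, add_zero]
    exact div_nonneg (Chebyshev.theta_nonneg _) (by positivity)
  | succ N hMN ih =>
    have hN : (0 : ℝ) < N := by exact_mod_cast (by omega : 0 < N)
    set t : ℝ := Chebyshev.theta N with ht
    have hth : t ≤ Real.log 4 * N := Chebyshev.theta_le_log4_mul_x hN.le
    have hl : 0 < Real.log 4 := Real.log_pos (by norm_num)
    have hsum : ∑ p ∈ (Finset.Ioc M (N + 1)).filter Nat.Prime, Real.log p / (p : ℝ) ^ 2 =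
        ∑ p ∈ (Finset.Ioc M N).filter Nat.Prime, Real.log p / (p : ℝ) ^ 2 +
          (Chebyshev.theta ((N + 1 : ℕ) : ℝ) - t) / ((N : ℝ) + 1) ^ 2 := by
      rw [ht, Chebyshev.theta, Chebyshev.theta, Nat.floor_natCast, Nat.floor_natCast,
        ← Finset.insert_Ioc_right_eq_Ioc_add_one (by omega : M ≤ N),
        ← Finset.insert_Ioc_right_eq_Ioc_add_one (by omega : 0 ≤ N),
        Finset.filter_insert, Finset.filter_insert]
      split_ifs with hp
      · rw [Finset.sum_insert (by simp), Finset.sum_insert (by simp)]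
        push_cast
        ring
      · simp
    rw [hsum]
    have hstep : t / (N : ℝ) ^ 2 - t / ((N : ℝ) + 1) ^ 2 ≤
        2 * Real.log 4 * (1 / (N : ℝ) - 1 / ((N : ℝ) + 1)) := by
      have e1 : t / (N : ℝ) ^ 2 - t / ((N : ℝ) + 1) ^ 2 =
          t * (2 * N + 1) / ((N : ℝ) ^ 2 * ((N : ℝ) + 1) ^ 2) := by
        field_simp
        ring
      have e2 : 2 * Real.log 4 * (1 / (N : ℝ) - 1 / ((N : ℝ) + 1)) =
          (Real.log 4 * N) * (2 * (N + 1)) / ((N : ℝ) ^ 2 * ((N : ℝ) + 1) ^ 2) := by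
        field_simp
        ring
      rw [e1, e2]
      gcongr
      linarith
    push_cast
    rw [sub_div]
    nlinarith [ih, hstep]

lemma sum_log_div_sq_tail_le {M N : ℕ} (hM : 1 ≤ M) :
    ∑ p ∈ (Finset.Ioc M N).filter Nat.Prime, Real.log p / (p : ℝ) ^ 2 ≤ 2 * Real.log 4 / M := by
  have hl : 0 < Real.log 4 := Real.log_pos (by norm_num)
  have hM' : (0 : ℝ) < M := by exact_mod_cast hM
  rcases le_total M N with h | h
  · refine (sum_log_div_sq_le hM h).trans ?_
    have hN : (0 : ℝ) < N := by exact_mod_cast (by omega : 0 < N)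
    have h1 : Chebyshev.theta N / (N : ℝ) ^ 2 ≤ Real.log 4 / N := by
      have := Chebyshev.theta_le_log4_mul_x hN.le
      rw [div_le_div_iff₀ (by positivity) hN]
      nlinarith
    have h2 : 0 ≤ Real.log 4 / N := by positivity
    calc _ ≤ Real.log 4 / N + 2 * Real.log 4 * (1 / (M : ℝ) - 1 / N) := by gcongr
      _ = 2 * Real.log 4 / M - Real.log 4 / N := by ring
      _ ≤ _ := by linarith
  · rw [Finset.Ioc_eq_empty (by omega)]
    simp only [Finset.filter_empty, Finset.sum_empty]
    positivity

lemma mem_primesUpTo {X : ℝ} {p : ℕ} : p ∈ primesUpTo X ↔ p.Prime ∧ (p : ℝ) ≤ X := by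
  simp only [primesUpTo, Finset.mem_filter, Finset.mem_range, and_iff_right_iff_imp]
  intro h
  exact Nat.lt_succ_of_le (Nat.le_floor h.2)

lemma sum_log_div_sq_primes_le {X : ℝ} (hX : 1 < X) :
    ∑ p ∈ (primesUpTo X).filter (fun p : ℕ => √X < p), Real.log p / (p : ℝ) ^ 2
      ≤ 2 * Real.log 4 / ⌊√X⌋₊ := by
  have hs : 1 < √X := Real.lt_sqrt_of_sq_lt (by simpa using hX)
  have hM : 1 ≤ ⌊√X⌋₊ := (Nat.one_le_floor_iff _).2 hs.le
  refine le_trans ?_ (sum_log_div_sq_tail_le (N := ⌊X⌋₊) hM)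
  refine Finset.sum_le_sum_of_subset_of_nonneg ?_ fun p _ _ => by positivity
  intro p hp
  rw [Finset.mem_filter, mem_primesUpTo] at hp
  rw [Finset.mem_filter, Finset.mem_Ioc]
  exact ⟨⟨(Nat.floor_lt (by positivity)).2 hp.2, Nat.le_floor hp.1.2⟩, hp.1.1⟩

lemma sum_inv_sq_primes_le_const {X : ℝ} (hX : 1 < X) :
    ∑ p ∈ (primesUpTo X).filter (fun p : ℕ => √X < p), 1 / (p : ℝ) ^ 2 ≤ 4 * Real.log 4 := by
  have hs : 1 < √X := Real.lt_sqrt_of_sq_lt (by simpa using hX)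
  have hM : (1 : ℝ) ≤ ⌊√X⌋₊ := by exact_mod_cast (Nat.one_le_floor_iff _).2 hs.le
  have hl : 0 < Real.log 4 := Real.log_pos (by norm_num)
  have h := sum_log_div_sq_primes_le hX
  have h1 : 2 * Real.log 4 / ⌊√X⌋₊ ≤ 2 * Real.log 4 := div_le_self (by positivity) hM
  have h2 : ∑ p ∈ (primesUpTo X).filter (fun p : ℕ => √X < p), 1 / (p : ℝ) ^ 2 ≤
      2 * ∑ p ∈ (primesUpTo X).filter (fun p : ℕ => √X < p), Real.log p / (p : ℝ) ^ 2 := by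
    rw [Finset.mul_sum]
    refine Finset.sum_le_sum fun p hp => ?_
    rw [Finset.mem_filter, mem_primesUpTo] at hp
    have hp2 : (2 : ℝ) ≤ p := by exact_mod_cast hp.1.1.two_le
    have : 1 / 2 ≤ Real.log p :=
      (by linarith [Real.log_two_gt_d9] : 1 / 2 ≤ Real.log 2).trans
        (Real.log_le_log (by norm_num) hp2)
    rw [← mul_div_assoc]
    gcongr
    linarith
  linarith

lemma sum_inv_sq_primes_le {X : ℝ} (hX : 1 < X) :
    ∑ p ∈ (primesUpTo X).filter (fun p : ℕ => √X < p), 1 / (p : ℝ) ^ 2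
      ≤ 8 * Real.log 4 * (X ^ (-(1 / 2 : ℝ)) / Real.log X) := by
  have hs : 1 < √X := Real.lt_sqrt_of_sq_lt (by simpa using hX)
  have hM : (1 : ℝ) ≤ ⌊√X⌋₊ := by exact_mod_cast (Nat.one_le_floor_iff _).2 hs.le
  have hM2 : √X / 2 ≤ ⌊√X⌋₊ := by linarith [Nat.lt_floor_add_one (√X)]
  have hl : 0 < Real.log 4 := Real.log_pos (by norm_num)
  have hlX : 0 < Real.log X := Real.log_pos hX
  have h2 : ∑ p ∈ (primesUpTo X).filter (fun p : ℕ => √X < p), 1 / (p : ℝ) ^ 2 ≤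
      2 / Real.log X *
        ∑ p ∈ (primesUpTo X).filter (fun p : ℕ => √X < p), Real.log p / (p : ℝ) ^ 2 := by
    rw [Finset.mul_sum]
    refine Finset.sum_le_sum fun p hp => ?_
    rw [Finset.mem_filter, mem_primesUpTo] at hp
    have : Real.log X / 2 ≤ Real.log p := by
      rw [← Real.log_sqrt (by linarith)]
      exact Real.log_le_log (by linarith) hp.2.le
    rw [← mul_div_assoc]
    gcongr
    rw [div_mul_eq_mul_div, le_div_iff₀ hlX]
    linarith
  calc _ ≤ 2 / Real.log X * (2 * Real.log 4 / ⌊√X⌋₊) :=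
        h2.trans (by gcongr; exact sum_log_div_sq_primes_le hX)
    _ ≤ 2 / Real.log X * (2 * Real.log 4 / (√X / 2)) := by gcongr
    _ = _ := by
        rw [Real.rpow_neg (by linarith), ← Real.sqrt_eq_rpow]
        field_simp
        ring

end ChebyshevTail

section LocalFactors

open PowerSeries

lemma norm_sq_div_pow_le_of_majorizedBy {P : PowerSeries ℂ} {N : ℕ} (hP : MajorizedBy P N) {p : ℕ}
    (hp : 2 ≤ p) (m : ℕ) : ‖coeff m P‖ ^ 2 / (p : ℝ) ^ m ≤
      (coeff m ((PowerSeries.mk 1 : PowerSeries ℝ) ^ N)) ^ 2 / 2 ^ m := by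
  have hp' : (2 : ℝ) ≤ p := by exact_mod_cast hp
  have := hP m
  gcongr

lemma summable_norm_sq_of_majorizedBy {P : PowerSeries ℂ} {N : ℕ} (hP : MajorizedBy P N) {p : ℕ}
    (hp : 2 ≤ p) : Summable fun m : ℕ => ‖coeff m P‖ ^ 2 / (p : ℝ) ^ m :=
  Summable.of_nonneg_of_le (fun m => by positivity) (norm_sq_div_pow_le_of_majorizedBy hP hp)
    (summable_sq_coeff_mk_one_pow N)

/-- The mean squares of two power series agreeing to first order differ by `O(p ^ (-2))`. -/
lemma abs_tsum_norm_sq_sub_le {P Q : PowerSeries ℂ} {N : ℕ} (hP : MajorizedBy P N)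
    (hQ : MajorizedBy Q N) (hPQ : ∀ m < 2, coeff m P = coeff m Q) {p : ℕ} (hp : 2 ≤ p) :
    |∑' m : ℕ, ‖coeff m P‖ ^ 2 / (p : ℝ) ^ m - ∑' m : ℕ, ‖coeff m Q‖ ^ 2 / (p : ℝ) ^ m| ≤
      4 * (∑' m : ℕ, (coeff m ((PowerSeries.mk 1 : PowerSeries ℝ) ^ N)) ^ 2 / 2 ^ m) *
        (1 / (p : ℝ) ^ 2) := by
  have hp' : (2 : ℝ) ≤ p := by exact_mod_cast hp
  set B : ℕ → ℝ := fun m => coeff m ((PowerSeries.mk 1 : PowerSeries ℝ) ^ N) with hB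
  have hsB : Summable fun m => B m ^ 2 / 2 ^ m := summable_sq_coeff_mk_one_pow N
  rw [← (summable_norm_sq_of_majorizedBy hP hp).tsum_sub (summable_norm_sq_of_majorizedBy hQ hp),
    ← Real.norm_eq_abs, mul_right_comm, ← tsum_mul_left]
  refine tsum_of_norm_bounded (hsB.mul_left _).hasSum fun m => ?_
  rw [Real.norm_eq_abs, ← sub_div, abs_div, abs_of_pos (by positivity : (0 : ℝ) < (p : ℝ) ^ m)]
  rcases lt_or_ge m 2 with hm | hm
  · rw [hPQ m hm, sub_self, abs_zero, zero_div]
    positivity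
  · obtain ⟨j, rfl⟩ := Nat.exists_eq_add_of_le hm
    have h1 : |‖coeff (2 + j) P‖ ^ 2 - ‖coeff (2 + j) Q‖ ^ 2| ≤ B (2 + j) ^ 2 := by
      have e1 : ‖coeff (2 + j) P‖ ^ 2 ≤ B (2 + j) ^ 2 := by
        have := hP (2 + j)
        gcongr
      have e2 : ‖coeff (2 + j) Q‖ ^ 2 ≤ B (2 + j) ^ 2 := by
        have := hQ (2 + j)
        gcongr
      exact abs_sub_le_of_nonneg_of_le (by positivity) e1 (by positivity) e2
    calc _ ≤ B (2 + j) ^ 2 / ((p : ℝ) ^ 2 * 2 ^ j) := by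
          rw [pow_add (p : ℝ)]
          gcongr
      _ = _ := by
          rw [pow_add (2 : ℝ)]
          field_simp
          norm_num

variable {q : ℕ}

/-- The Euler factor of `𝓛^ℓ` at `p`, as a power series in `p ^ (-s)`. -/
noncomputable def localL (ℓ : DirichletCharacter ℂ q → ℕ) (p : ℕ) : PowerSeries ℂ :=
  ∏ χ : DirichletCharacter ℂ q, geomSeries (χ (p : ZMod q)) ^ ℓ χ

/-- The power series expansion of `∏ (1 + χ(p) ^ 2 z ^ 2 / 2) ^ (-ℓ χ)`. -/
noncomputable def localCorrection (ℓ : DirichletCharacter ℂ q → ℕ) (p : ℕ) : PowerSeries ℂ :=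
  ∏ χ : DirichletCharacter ℂ q, (geomSeries (χ (p : ZMod q) * (I / √2)) *
    geomSeries (-(χ (p : ZMod q) * (I / √2)))) ^ ℓ χ

/-- The Euler factor of `𝓟*_X^ℓ` at `p`. -/
noncomputable def localPstar (X : ℝ) (ℓ : DirichletCharacter ℂ q → ℕ) (p : ℕ) : PowerSeries ℂ :=
  if p ∈ primesUpTo X then localL ℓ p * (if √X < p then localCorrection ℓ p else 1) else 1

lemma coeff_localL (ℓ : DirichletCharacter ℂ q → ℕ) {p : ℕ} (hp : p.Prime) (m : ℕ) :
    coeff m (localL ℓ p) = dcoef ℓ (p ^ m) := by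
  have h : restrictToPowers p hp (dcoef ℓ) = localL ℓ p := by
    rw [dcoef, localL, map_prod]
    refine Finset.prod_congr rfl fun χ _ => ?_
    rw [map_pow]
    congr 1
    ext j
    simp [restrictToPowers, geomSeries, chiArith, hp.ne_zero]
  rw [← h]
  simp [restrictToPowers]

lemma coeff_zero_localL (ℓ : DirichletCharacter ℂ q → ℕ) (p : ℕ) : coeff 0 (localL ℓ p) = 1 := by
  rw [coeff_zero_eq_constantCoeff_apply, localL, map_prod]
  refine Finset.prod_eq_one fun χ _ => ?_
  rw [map_pow, ← coeff_zero_eq_constantCoeff_apply]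
  simp [geomSeries]

lemma trivialToFirstOrder_localCorrection (ℓ : DirichletCharacter ℂ q → ℕ) (p : ℕ) :
    TrivialToFirstOrder (localCorrection ℓ p) := by
  refine Finset.prod_induction _ TrivialToFirstOrder (fun _ _ => TrivialToFirstOrder.mul)
    TrivialToFirstOrder.one fun χ _ => TrivialToFirstOrder.pow ⟨?_, ?_⟩ _
  · simp [geomSeries]
  · rw [coeff_one_mul_eq]
    simp [geomSeries]

lemma coeff_localPstar {X : ℝ} (ℓ : DirichletCharacter ℂ q → ℕ) {p : ℕ} (hp : p ∈ primesUpTo X)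
    {m : ℕ} (hm : m < 2) : coeff m (localPstar X ℓ p) = coeff m (localL ℓ p) := by
  rw [localPstar, if_pos hp]
  split_ifs
  · exact (trivialToFirstOrder_localCorrection ℓ p).mul_left_coeff hm
  · rw [mul_one]

lemma coeff_zero_localPstar (X : ℝ) (ℓ : DirichletCharacter ℂ q → ℕ) (p : ℕ) :
    coeff 0 (localPstar X ℓ p) = 1 := by
  by_cases hp : p ∈ primesUpTo X
  · rw [coeff_localPstar ℓ hp two_pos, coeff_zero_localL]
  · simp [localPstar, hp]

lemma majorizedBy_localL (ℓ : DirichletCharacter ℂ q → ℕ) (p : ℕ) :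
    MajorizedBy (localL ℓ p) (∑ χ, ℓ χ) := by
  refine (MajorizedBy.prod _ fun χ _ =>
    (majorizedBy_geomSeries (DirichletCharacter.norm_le_one χ _)).pow (ℓ χ)).mono ?_
  simp

lemma norm_I_div_sqrt_two : ‖I / (√2 : ℂ)‖ = (√2)⁻¹ := by
  simp [abs_of_nonneg (Real.sqrt_nonneg 2)]

lemma norm_mul_I_div_sqrt_two_le (χ : DirichletCharacter ℂ q) (a : ZMod q) :
    ‖χ a * (I / √2)‖ ≤ 1 := by
  rw [norm_mul, norm_I_div_sqrt_two]
  exact mul_le_one₀ (DirichletCharacter.norm_le_one χ a) (by positivity)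
    (inv_le_one_of_one_le₀ (Real.one_le_sqrt.mpr one_le_two))

lemma majorizedBy_localCorrection (ℓ : DirichletCharacter ℂ q → ℕ) (p : ℕ) :
    MajorizedBy (localCorrection ℓ p) (2 * ∑ χ, ℓ χ) := by
  refine (MajorizedBy.prod _ fun χ _ =>
    ((majorizedBy_geomSeries (norm_mul_I_div_sqrt_two_le χ _)).mul
      (majorizedBy_geomSeries ?_)).pow (ℓ χ)).mono ?_
  · rw [norm_neg]
    exact norm_mul_I_div_sqrt_two_le χ _
  · rw [Finset.mul_sum]

lemma majorizedBy_localPstar (X : ℝ) (ℓ : DirichletCharacter ℂ q → ℕ) (p : ℕ) :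
    MajorizedBy (localPstar X ℓ p) (3 * ∑ χ, ℓ χ) := by
  rw [localPstar]
  split_ifs
  · exact ((majorizedBy_localL ℓ p).mul (majorizedBy_localCorrection ℓ p)).mono (by omega)
  · rw [mul_one]
    exact (majorizedBy_localL ℓ p).mono (by omega)
  · exact MajorizedBy.one.mono (Nat.zero_le _)

lemma evaluatesTo_localL (ℓ : DirichletCharacter ℂ q → ℕ) (p : ℕ) {z : ℂ} (hz : ‖z‖ < 1) :
    EvaluatesTo (localL ℓ p) z (∏ χ, ((1 - χ (p : ZMod q) * z)⁻¹) ^ ℓ χ) := by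
  refine EvaluatesTo.prod _ fun χ _ => (evaluatesTo_geomSeries ?_).pow _
  rw [norm_mul]
  exact mul_lt_one_of_nonneg_of_lt_one_right (DirichletCharacter.norm_le_one χ _)
    (norm_nonneg _) hz

lemma evaluatesTo_localCorrection (ℓ : DirichletCharacter ℂ q → ℕ) (p : ℕ) {z : ℂ}
    (hz : ‖z‖ < 1) : EvaluatesTo (localCorrection ℓ p) z
      (∏ χ, ((1 + χ (p : ZMod q) ^ 2 * z ^ 2 / 2)⁻¹) ^ ℓ χ) := by
  refine EvaluatesTo.prod _ fun χ _ => EvaluatesTo.pow ?_ _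
  have h1 : ‖χ (p : ZMod q) * (I / √2) * z‖ < 1 := by
    rw [norm_mul]
    exact mul_lt_one_of_nonneg_of_lt_one_right (norm_mul_I_div_sqrt_two_le χ _) (norm_nonneg _) hz
  have h2 := (evaluatesTo_geomSeries h1).mul
    (evaluatesTo_geomSeries (c := -(χ (p : ZMod q) * (I / √2))) (z := z)
      (by rwa [neg_mul, norm_neg]))
  have h3 : (I / (√2 : ℂ)) ^ 2 = -1 / 2 := by
    rw [div_pow, I_sq, ← Complex.ofReal_pow, Real.sq_sqrt (by norm_num)]
    norm_num
  convert h2 using 1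
  rw [← mul_inv]
  congr 1
  linear_combination (χ (p : ZMod q) ^ 2 * z ^ 2) * h3

lemma evaluatesTo_localPstar {X : ℝ} (ℓ : DirichletCharacter ℂ q → ℕ) {p : ℕ}
    (hp : p ∈ primesUpTo X) {z : ℂ} (hz : ‖z‖ < 1) :
    EvaluatesTo (localPstar X ℓ p) z ((∏ χ, ((1 - χ (p : ZMod q) * z)⁻¹) ^ ℓ χ) *
      (if √X < p then ∏ χ, ((1 + χ (p : ZMod q) ^ 2 * z ^ 2 / 2)⁻¹) ^ ℓ χ else 1)) := by
  rw [localPstar, if_pos hp]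
  refine (evaluatesTo_localL ℓ p hz).mul ?_
  split_ifs
  · exact evaluatesTo_localCorrection ℓ p hz
  · exact EvaluatesTo.one z

lemma PstarXl_eq_prod (X : ℝ) (ℓ : DirichletCharacter ℂ q → ℕ) (s : ℂ) :
    PstarXl X ℓ s = ∏ p ∈ primesUpTo X,
      ((∏ χ, ((1 - χ (p : ZMod q) * (p : ℂ) ^ (-s))⁻¹) ^ ℓ χ) *
      (if √X < p then
        ∏ χ, ((1 + χ (p : ZMod q) ^ 2 * ((p : ℂ) ^ (-s)) ^ 2 / 2)⁻¹) ^ ℓ χ else 1)) := by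
  rw [Finset.prod_mul_distrib, ← Finset.prod_filter, Finset.prod_comm (s := primesUpTo X),
    Finset.prod_comm (s := (primesUpTo X).filter _), ← Finset.prod_mul_distrib, PstarXl]
  refine Finset.prod_congr rfl fun χ _ => ?_
  rw [Finset.prod_pow, Finset.prod_pow, ← mul_pow, PstarX]
  congr 2
  refine Finset.prod_congr rfl fun p _ => ?_
  have : (p : ℂ) ^ (2 * s) = ((p : ℂ) ^ s) ^ 2 := by
    rw [← Complex.cpow_nat_mul, Nat.cast_ofNat]
  rw [this, Complex.cpow_neg, inv_pow]
  congr 2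
  rw [div_mul_eq_div_div_swap, div_eq_mul_inv (χ (p : ZMod q) ^ 2)]

lemma LSeries_mulOfLocal_localPstar (X : ℝ) (ℓ : DirichletCharacter ℂ q → ℕ) {s : ℂ}
    (hs : 1 < s.re) : LSeriesSummable (mulOfLocal (localPstar X ℓ)) s ∧
      LSeries (mulOfLocal (localPstar X ℓ)) s = PstarXl X ℓ s := by
  rw [PstarXl_eq_prod]
  refine LSeries_mulOfLocal (fun p hp => by rw [localPstar, if_neg hp])
    (coeff_zero_localPstar X ℓ) (fun p hp => (mem_primesUpTo.mp hp).1) fun p hp => ?_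
  have hpp := (mem_primesUpTo.mp hp).1
  refine evaluatesTo_localPstar ℓ hp ?_
  rw [Complex.norm_natCast_cpow_of_pos hpp.pos, Complex.neg_re]
  exact Real.rpow_lt_one_of_one_lt_of_neg (by exact_mod_cast hpp.one_lt) (by linarith)

lemma eq_mulOfLocal_localPstar {X : ℝ} {ℓ : DirichletCharacter ℂ q → ℕ} {β : ℕ → ℂ}
    (hβ : ∀ s : ℂ, 1 < s.re → LSeriesSummable β s ∧ LSeries β s = PstarXl X ℓ s)
    {n : ℕ} (hn : n ≠ 0) : β n = mulOfLocal (localPstar X ℓ) n := by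
  have htop : ∀ f : ℕ → ℂ, LSeriesSummable f 2 → LSeries.abscissaOfAbsConv f < ⊤ := fun f hf =>
    hf.abscissaOfAbsConv_le.trans_lt (EReal.coe_lt_top _)
  refine LSeries.eq_of_LSeries_eventually_eq (htop _ (hβ 2 (by norm_num)).1)
    (htop _ (LSeries_mulOfLocal_localPstar X ℓ (by norm_num)).1) ?_ hn
  filter_upwards [eventually_gt_atTop 1] with x hx
  rw [(hβ x (by simpa using hx)).2, (LSeries_mulOfLocal_localPstar X ℓ (by simpa using hx)).2]

end LocalFactors

lemma exp_sub_one_le_mul_exp (t : ℝ) : Real.exp t - 1 ≤ t * Real.exp t := by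
  have h := mul_le_mul_of_nonneg_right (Real.one_sub_le_exp_neg t) (Real.exp_pos t).le
  rw [← Real.exp_add, neg_add_cancel, Real.exp_zero] at h
  linarith

/-- Comparison of two finite products, one with factors at least `1`. -/
lemma exists_relative_error {ι : Type*} (s : Finset ι) {A D b : ι → ℝ}
    (hD : ∀ i ∈ s, 1 ≤ D i) (h : ∀ i ∈ s, |A i - D i| ≤ b i) :
    ∃ E : ℝ, |E| ≤ (∑ i ∈ s, b i) * Real.exp (∑ i ∈ s, b i) ∧
      ∏ i ∈ s, A i = (1 + E) * ∏ i ∈ s, D i := by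
  refine ⟨∏ i ∈ s, (1 + (A i / D i - 1)) - 1, ?_, ?_⟩
  · refine (Finset.norm_prod_one_add_sub_one_le s fun i => A i / D i - 1).trans ?_
    refine le_trans ?_ (exp_sub_one_le_mul_exp _)
    gcongr with i hi
    have hDi := hD i hi
    have hpos : 0 < D i := by linarith
    rw [div_sub_one hpos.ne', norm_div, Real.norm_eq_abs, Real.norm_eq_abs, abs_of_pos hpos]
    exact (div_le_self (abs_nonneg _) hDi).trans (h i hi)
  · rw [add_sub_cancel, ← Finset.prod_mul_distrib]
    refine Finset.prod_congr rfl fun i hi => ?_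
    have hpos : 0 < D i := by linarith [hD i hi]
    field_simp
    ring

/-- Let `β_ℓ` be the coefficients of the Dirichlet series of `𝓟*_X^ℓ(s)`.
Then `Σ_{n ∈ 𝒮_q(X)} |β_ℓ(n)|²/n = (1 + O_k(X^{−1/2}/log X)) ∏_{p ≤ X, p ∤ q} Σ_m |d_ℓ(p^m)|²/p^m`,
where the implied constant depends only on `k`. -/
theorem beta_mean_value (k : ℕ) :
    ∃ C : ℝ, ∀ (q : ℕ) [NeZero q], ∀ ℓ : DirichletCharacter ℂ q → ℕ,
      (∑ χ : DirichletCharacter ℂ q, ℓ χ = k) →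
      ∀ X : ℝ, (q : ℝ) ^ 2 < X →
      ∀ β : ℕ → ℂ,
        (∀ s : ℂ, 1 < s.re → LSeriesSummable β s ∧ LSeries β s = PstarXl X ℓ s) →
        ∃ E : ℝ, |E| ≤ C * X ^ (-(1/2 : ℝ)) / Real.log X ∧
          (∑' n : ℕ,
            if (1 ≤ n ∧ ∀ p : ℕ, p.Prime → p ∣ n → ((p : ℝ) ≤ X ∧ ¬ p ∣ q))
              then ‖β n‖ ^ 2 / (n : ℝ) else 0)
            = (1 + E) * ∏ p ∈ (primesUpTo X).filter (fun p : ℕ => ¬ p ∣ q),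
                ∑' m : ℕ, ‖dcoef ℓ (p ^ m)‖ ^ 2 / (p : ℝ) ^ m := by
  set K : ℝ := ∑' m : ℕ,
    (PowerSeries.coeff m ((PowerSeries.mk 1 : PowerSeries ℝ) ^ (3 * k))) ^ 2 / 2 ^ m with hK
  have hK0 : 0 ≤ K := tsum_nonneg fun m => by positivity
  have hl : 0 < Real.log 4 := Real.log_pos (by norm_num)
  refine ⟨4 * K * (8 * Real.log 4) * Real.exp (4 * K * (4 * Real.log 4)), ?_⟩
  intro q _ ℓ hℓ X hqX β hβ
  have hX : 1 < X := by
    have : (1 : ℝ) ≤ q := by exact_mod_cast NeZero.one_le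
    nlinarith
  have hlX : 0 < Real.log X := Real.log_pos hX
  set S := (primesUpTo X).filter fun p : ℕ => ¬ p ∣ q with hS
  have hSmem : ∀ p ∈ S, p ∈ primesUpTo X := fun p hp => (Finset.mem_filter.mp hp).1
  have hSp : ∀ p ∈ S, p.Prime := fun p hp => (mem_primesUpTo.mp (hSmem p hp)).1
  have hmajL : ∀ p, MajorizedBy (localL ℓ p) (3 * k) := fun p =>
    (majorizedBy_localL ℓ p).mono (by omega)
  have hmajP : ∀ p, MajorizedBy (localPstar X ℓ p) (3 * k) := fun p =>
    (majorizedBy_localPstar X ℓ p).mono (by omega)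
  have hlhs := tsum_norm_sq_mulOfLocal (coeff_zero_localPstar X ℓ) S hSp
    fun p hp => summable_norm_sq_of_majorizedBy (hmajP p) hp.two_le
  obtain ⟨E, hE, hprod⟩ := exists_relative_error S
    (A := fun p => ∑' m : ℕ, ‖PowerSeries.coeff m (localPstar X ℓ p)‖ ^ 2 / (p : ℝ) ^ m)
    (D := fun p => ∑' m : ℕ, ‖PowerSeries.coeff m (localL ℓ p)‖ ^ 2 / (p : ℝ) ^ m)
    (b := fun p => if √X < p then 4 * K * (1 / (p : ℝ) ^ 2) else 0)
    (fun p hp => by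
      have h := (summable_norm_sq_of_majorizedBy (hmajL p) (hSp p hp).two_le).le_tsum 0
        fun m _ => by positivity
      rwa [coeff_zero_localL, norm_one, one_pow, pow_zero, div_one] at h)
    (fun p hp => by
      split_ifs with hpX
      · exact abs_tsum_norm_sq_sub_le (hmajP p) (hmajL p)
          (fun m hm => coeff_localPstar ℓ (hSmem p hp) hm) (hSp p hp).two_le
      · rw [localPstar, if_pos (hSmem p hp), if_neg hpX, mul_one, sub_self, abs_zero])
  have hb : ∑ p ∈ S, (if √X < p then 4 * K * (1 / (p : ℝ) ^ 2) else 0) ≤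
      4 * K * ∑ p ∈ (primesUpTo X).filter (fun p : ℕ => √X < p), 1 / (p : ℝ) ^ 2 := by
    rw [← Finset.sum_filter, Finset.mul_sum]
    refine Finset.sum_le_sum_of_subset_of_nonneg ?_ fun p _ _ => by positivity
    exact Finset.filter_subset_filter _ (Finset.filter_subset _ _)
  have hb1 := hb.trans (mul_le_mul_of_nonneg_left (sum_inv_sq_primes_le hX) (by positivity))
  have hb2 := hb.trans (mul_le_mul_of_nonneg_left (sum_inv_sq_primes_le_const hX) (by positivity))
  refine ⟨E, ?_, ?_⟩
  · calc |E| ≤ _ := hE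
      _ ≤ 4 * K * (8 * Real.log 4 * (X ^ (-(1 / 2 : ℝ)) / Real.log X)) *
          Real.exp (4 * K * (4 * Real.log 4)) := by gcongr
      _ = _ := by ring
  · calc _ = ∑' n : ℕ, if n ∈ Nat.factoredNumbers S then
            ‖mulOfLocal (localPstar X ℓ) n‖ ^ 2 / (n : ℝ) else 0 := by
          refine tsum_congr fun n => ?_
          rcases eq_or_ne n 0 with rfl | hn
          · simp [Nat.mem_factoredNumbers]
          rw [eq_mulOfLocal_localPstar hβ hn]
          refine if_congr ?_ rfl rfl
          rw [Nat.mem_factoredNumbers']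
          simp only [hS, Finset.mem_filter, mem_primesUpTo]
          constructor
          · rintro ⟨-, h⟩ p hp hpn
            exact ⟨⟨hp, (h p hp hpn).1⟩, (h p hp hpn).2⟩
          · intro h
            exact ⟨Nat.one_le_iff_ne_zero.mpr hn, fun p hp hpn =>
              ⟨(h p hp hpn).1.2, (h p hp hpn).2⟩⟩
      _ = _ := hlhs
      _ = _ := hprod
      _ = _ := by
          congr 1
          refine Finset.prod_congr rfl fun p hp => ?_
          simp_rw [coeff_localL ℓ (hSp p hp)]
end
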